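/- arXiv:2501.13323 — 4 statements merged into one kernel-verified Lean document; each statement's English description precedes it below -/
import Mathlib

section
/- Consider the sparse linear regression model with all quantities k=k_n, p=p_n, τ=τ_n, σ=σ_n depending on n, asymptotics as n→∞, and μ = τ/σ. Assume k/p → 0, μ → ∞, μ = o(√(log(p/k))) (Regime II), and (k·log(p/k))/n → 0. Then the optimally tuned ridge estimator is suboptimal: inf_{λ>0} sup_{β∈Θ(k,τ)} E_β‖β̂^R(λ) − β‖₂² ≥ kτ²·(1 − (kτ²/(pσ²))·(1+o(1))); equivalently, with I_n = inf_{λ>0} sup_{β∈Θ(k,τ)} E_β‖β̂^R(λ) − β‖₂², limsup_n (1 − I_n/(kτ²)) · (pσ²/(kτ²)) ≤ 1. -/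
open MeasureTheory ProbabilityTheory Filter Matrix
open scoped NNReal ENNReal

noncomputable section

/-- Joint law of the data: a design matrix with i.i.d. `N(0, (1/n) I_p)` rows
(entries i.i.d. `N(0, 1/n)`) and an independent noise vector with i.i.d. `N(0,1)` entries. -/
def model (n p : ℕ) : Measure ((Fin n → Fin p → ℝ) × (Fin n → ℝ)) :=
  (Measure.pi fun _ : Fin n => Measure.pi fun _ : Fin p => gaussianReal 0 (n : ℝ≥0)⁻¹).prod
    (Measure.pi fun _ : Fin n => gaussianReal 0 1)

/-- Expected squared-error risk `E_β ‖est(X, Xβ + σ z) − β‖₂²` of an estimator `est`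
under the true parameter `β` and noise level `σ`. -/
def risk (n p : ℕ) (σ : ℝ)
    (est : (Fin n → Fin p → ℝ) × (Fin n → ℝ) → Fin p → ℝ) (β : Fin p → ℝ) : ℝ≥0∞ :=
  ∫⁻ ω, ENNReal.ofReal
      (∑ j, (est (ω.1, fun i => (∑ l, ω.1 i l * β l) + σ * ω.2 i) j - β j) ^ 2) ∂ model n p

/-- The `ℓ₀` norm: number of nonzero coordinates. -/
def l0norm {p : ℕ} (β : Fin p → ℝ) : ℕ := (Finset.univ.filter fun j => β j ≠ 0).card

/-- The SNR-aware sparse parameter space `Θ(k, τ)`. -/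
def Theta (p k : ℕ) (τ : ℝ) : Set (Fin p → ℝ) :=
  {β | l0norm β ≤ k ∧ ∑ j, β j ^ 2 ≤ k * τ ^ 2}

/-- The minimax risk `R(Θ(k,τ), σ)`: infimum over measurable estimators of the supremum
risk over `Θ(k,τ)`. -/
def minimaxRisk (n p k : ℕ) (τ σ : ℝ) : ℝ≥0∞ :=
  ⨅ (est : (Fin n → Fin p → ℝ) × (Fin n → ℝ) → Fin p → ℝ) (_ : Measurable est),
    ⨆ β ∈ Theta p k τ, risk n p σ est β

/-- The ridge regression estimator `β̂^R(λ) = (XᵀX + λ I_p)⁻¹ Xᵀ y`. -/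
def ridgeEst (n p : ℕ) (lam : ℝ)
    (ω : (Fin n → Fin p → ℝ) × (Fin n → ℝ)) : Fin p → ℝ :=
  ((Matrix.of ω.1)ᵀ * Matrix.of ω.1 + lam • (1 : Matrix (Fin p) (Fin p) ℝ))⁻¹ *ᵥ
    ((Matrix.of ω.1)ᵀ *ᵥ ω.2)

lemma integrable_sq_linear_gaussian {n : ℕ} (c : Fin n → ℝ) :
    Integrable (fun z : Fin n → ℝ => (∑ i, c i * z i) ^ 2)
      (Measure.pi fun _ : Fin n => gaussianReal 0 1) := by
  have h : MemLp (fun z : Fin n → ℝ => ∑ i, c i * z i) 2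
      (Measure.pi fun _ : Fin n => gaussianReal 0 1) := by
    refine memLp_finsetSum _ fun i _ => MemLp.const_mul ?_ _
    exact (IsGaussian.memLp_two_id (μ := gaussianReal 0 1)).comp_measurePreserving
      (measurePreserving_eval (fun _ : Fin n => gaussianReal 0 1) i)
  exact h.integrable_sq

lemma integral_sq_linear_gaussian {n : ℕ} (c : Fin n → ℝ) :
    ∫ z, (∑ i, c i * z i) ^ 2 ∂(Measure.pi fun _ : Fin n => gaussianReal 0 1)
      = ∑ i, c i ^ 2 := by
  have hint : ∀ i : Fin n, Integrable (fun z : Fin n → ℝ => c i * z i)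
      (Measure.pi fun _ : Fin n => gaussianReal 0 1) := fun i =>
    Integrable.const_mul ((measurePreserving_eval (fun _ : Fin n => gaussianReal 0 1) i).integrable_comp
      (g := id) aestronglyMeasurable_id |>.2
        ((IsGaussian.memLp_two_id (μ := gaussianReal 0 1)).integrable (by norm_num))) _
  have hmean : ∫ z, (∑ i, c i * z i) ∂(Measure.pi fun _ : Fin n => gaussianReal 0 1) = 0 := by
    rw [integral_finsetSum _ fun i _ => hint i]
    refine Finset.sum_eq_zero fun i _ => ?_
    have h := integral_comp_eval (μ := fun _ : Fin n => gaussianReal 0 1) (i := i) (f := id)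
      aestronglyMeasurable_id
    simp only [id, integral_id_gaussianReal] at h
    rw [integral_const_mul, h, mul_zero]
  rw [← variance_of_integral_eq_zero
    (Finset.measurable_sum _ fun i _ => by fun_prop).aemeasurable hmean]
  have h := variance_sum_pi (μ := fun _ : Fin n => gaussianReal 0 1)
    (X := fun i x => c i * id x) fun i => IsGaussian.memLp_two_id.const_mul _
  simp only [variance_const_mul, variance_id_gaussianReal, NNReal.coe_one, mul_one] at h
  rw [← h]
  congr 1
  ext z
  simp

/-- The squared Frobenius norm of a design with i.i.d. `N(0, 1/n)` entries has mean at most `p`. -/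
lemma lintegral_frobenius_design_le (n p : ℕ) {c : ℝ} (hc : 0 ≤ c) :
    ∫⁻ X : Fin n → Fin p → ℝ, ENNReal.ofReal (c * ∑ i, ∑ j, X i j ^ 2)
      ∂(Measure.pi fun _ : Fin n => Measure.pi fun _ : Fin p => gaussianReal 0 (n : ℝ≥0)⁻¹)
      ≤ ENNReal.ofReal (c * p) := by
  have hentry : ∀ i j, ∫⁻ X : Fin n → Fin p → ℝ, ENNReal.ofReal (X i j ^ 2)
      ∂(Measure.pi fun _ : Fin n => Measure.pi fun _ : Fin p => gaussianReal 0 (n : ℝ≥0)⁻¹)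
      = ENNReal.ofReal ((n : ℝ)⁻¹) := by
    intro i j
    have hm := (measurePreserving_eval (fun _ : Fin p => gaussianReal 0 (n : ℝ≥0)⁻¹) j).comp
      (measurePreserving_eval
        (fun _ : Fin n => Measure.pi fun _ : Fin p => gaussianReal 0 (n : ℝ≥0)⁻¹) i)
    refine (hm.lintegral_comp (f := fun x => ENNReal.ofReal (x ^ 2)) (by fun_prop)).trans ?_
    have hsq := (IsGaussian.memLp_two_id (μ := gaussianReal 0 (n : ℝ≥0)⁻¹)).integrable_sq
    simp only [id] at hsq
    rw [← ofReal_integral_eq_lintegral_ofReal hsq (ae_of_all _ fun x => sq_nonneg _)]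
    have := variance_of_integral_eq_zero (X := id) (μ := gaussianReal 0 (n : ℝ≥0)⁻¹)
      aemeasurable_id (by simp)
    simp only [id] at this ⊢
    rw [← this]
    simp
  simp_rw [ENNReal.ofReal_mul hc]
  rw [lintegral_const_mul _ (by fun_prop)]
  gcongr
  simp_rw [ENNReal.ofReal_sum_of_nonneg fun i _ => Finset.sum_nonneg fun j _ => sq_nonneg _,
    ENNReal.ofReal_sum_of_nonneg fun j _ => sq_nonneg _]
  rw [lintegral_finsetSum _ fun i _ => by fun_prop]
  have hrow : ∀ i : Fin n, ∫⁻ X : Fin n → Fin p → ℝ, ∑ j, ENNReal.ofReal (X i j ^ 2)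
      ∂(Measure.pi fun _ : Fin n => Measure.pi fun _ : Fin p => gaussianReal 0 (n : ℝ≥0)⁻¹)
      = ∑ _j : Fin p, ENNReal.ofReal ((n : ℝ)⁻¹) := fun i => by
    rw [lintegral_finsetSum _ fun j _ => by fun_prop]
    exact Finset.sum_congr rfl fun j _ => hentry i j
  simp only [hrow, Finset.sum_const, Finset.card_univ, Fintype.card_fin, nsmul_eq_mul]
  rw [← ENNReal.ofReal_natCast, ← ENNReal.ofReal_natCast, ← ENNReal.ofReal_mul (by positivity),
    ← ENNReal.ofReal_mul (by positivity)]
  apply ENNReal.ofReal_le_ofReal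
  rcases Nat.eq_zero_or_pos n with rfl | hn
  · simp
  · field_simp
    exact le_rfl

/-- Loss of the linear estimator `M y` at noise `z`. -/
def linearLoss {n p : ℕ} (M : Matrix (Fin p) (Fin n) ℝ) (X : Fin n → Fin p → ℝ) (σ : ℝ)
    (β : Fin p → ℝ) (z : Fin n → ℝ) : ℝ :=
  ∑ j, ((M *ᵥ fun i => (∑ l, X i l * β l) + σ * z i) j - β j) ^ 2

lemma linearLoss_single {n p : ℕ} (M : Matrix (Fin p) (Fin n) ℝ) (X : Fin n → Fin p → ℝ)
    (σ t : ℝ) (m : Fin p) (z : Fin n → ℝ) :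
    linearLoss M X σ (Pi.single m t) z
      = ∑ j, (t * (M * Matrix.of X - 1 : Matrix (Fin p) (Fin p) ℝ) j m + σ * ∑ i, M j i * z i) ^ 2 := by
  refine Finset.sum_congr rfl fun j _ => ?_
  congr 1
  simp only [mulVec, dotProduct, Matrix.sub_apply, Matrix.mul_apply, of_apply, Pi.single_apply,
    mul_ite, mul_zero, Finset.sum_ite_eq', Finset.mem_univ, if_true, mul_add,
    Finset.sum_add_distrib, Matrix.one_apply, mul_sub, Finset.mul_sum, mul_one]
  rw [Finset.sum_congr rfl fun i _ => show M j i * (X i m * t) = t * (M j i * X i m) by ring,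
    Finset.sum_congr rfl fun i _ => show M j i * (σ * z i) = σ * (M j i * z i) by ring]
  ring

lemma sum_linearLoss_single_add_neg {n p : ℕ} (M : Matrix (Fin p) (Fin n) ℝ)
    (X : Fin n → Fin p → ℝ) (σ t : ℝ) (z : Fin n → ℝ) :
    ∑ m, (linearLoss M X σ (Pi.single m t) z + linearLoss M X σ (Pi.single m (-t)) z)
      = 2 * (t ^ 2 * ∑ m, ∑ j, (M * Matrix.of X - 1 : Matrix (Fin p) (Fin p) ℝ) j m ^ 2)
        + 2 * (p * σ ^ 2) * ∑ j, (∑ i, M j i * z i) ^ 2 := by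
  have h : ∀ m, linearLoss M X σ (Pi.single m t) z + linearLoss M X σ (Pi.single m (-t)) z
      = 2 * (t ^ 2 * ∑ j, (M * Matrix.of X - 1 : Matrix (Fin p) (Fin p) ℝ) j m ^ 2)
        + 2 * σ ^ 2 * ∑ j, (∑ i, M j i * z i) ^ 2 := by
    intro m
    rw [linearLoss_single, linearLoss_single]
    rw [Finset.mul_sum, Finset.mul_sum, Finset.mul_sum, ← Finset.sum_add_distrib,
      ← Finset.sum_add_distrib]
    refine Finset.sum_congr rfl fun j _ => ?_
    ring
  simp only [h, Finset.sum_add_distrib, ← Finset.mul_sum, Finset.sum_const, Finset.card_univ,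
    Fintype.card_fin, nsmul_eq_mul]
  ring

lemma frobenius_bias_variance_lower_bound {n p : ℕ} (M : Matrix (Fin p) (Fin n) ℝ)
    (X : Fin n → Fin p → ℝ) {K v : ℝ} (hK : 0 ≤ K) (hv : 0 < v) :
    K * p ≤ K * ∑ m, ∑ j, (M * Matrix.of X - 1 : Matrix (Fin p) (Fin p) ℝ) j m ^ 2 + v * ∑ j, ∑ i, M j i ^ 2
      + K ^ 2 / v * ∑ i, ∑ j, X i j ^ 2 := by
  have h1 : (p : ℝ) - 2 * ∑ j, ∑ i, M j i * X i j
      ≤ ∑ m, ∑ j, (M * Matrix.of X - 1 : Matrix (Fin p) (Fin p) ℝ) j m ^ 2 := by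
    have hp : (p : ℝ) = ∑ _m : Fin p, (1 : ℝ) := by simp
    rw [hp, Finset.mul_sum, ← Finset.sum_sub_distrib]
    refine Finset.sum_le_sum fun m _ => ?_
    refine le_trans ?_ (Finset.single_le_sum (f := fun j => (M * Matrix.of X - 1 : Matrix (Fin p) (Fin p) ℝ) j m ^ 2)
      (fun j _ => sq_nonneg _) (Finset.mem_univ m))
    simp only [Matrix.sub_apply, Matrix.mul_apply, of_apply, Matrix.one_apply_eq]
    nlinarith [sq_nonneg (∑ i, M m i * X i m)]
  have h2 : 2 * K * ∑ j, ∑ i, M j i * X i j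
      ≤ v * ∑ j, ∑ i, M j i ^ 2 + K ^ 2 / v * ∑ i, ∑ j, X i j ^ 2 := by
    rw [Finset.sum_comm (f := fun i j => X i j ^ 2)]
    simp only [Finset.mul_sum, ← Finset.sum_add_distrib]
    refine Finset.sum_le_sum fun j _ => Finset.sum_le_sum fun i _ => ?_
    have h : v * M j i ^ 2 + K ^ 2 / v * X i j ^ 2 - 2 * K * (M j i * X i j)
        = (v * M j i - K * X i j) ^ 2 / v := by
      field_simp
      ring
    have : 0 ≤ (v * M j i - K * X i j) ^ 2 / v := by positivity
    linarith
  nlinarith [mul_le_mul_of_nonneg_left h1 hK]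

lemma measurable_linearLoss {n p : ℕ} {M : (Fin n → Fin p → ℝ) → Matrix (Fin p) (Fin n) ℝ}
    (hM : ∀ j i, Measurable fun X => M X j i) (σ : ℝ) (β : Fin p → ℝ) :
    Measurable fun ω : (Fin n → Fin p → ℝ) × (Fin n → ℝ) =>
      linearLoss (M ω.1) ω.1 σ β ω.2 := by
  have h : ∀ j i, Measurable fun ω : (Fin n → Fin p → ℝ) × (Fin n → ℝ) => M ω.1 j i :=
    fun j i => (hM j i).comp measurable_fst
  unfold linearLoss
  simp only [mulVec, dotProduct]
  fun_prop

lemma single_mem_Theta {p k : ℕ} (hk : 0 < k) (m : Fin p) {t τ : ℝ} (ht : t ^ 2 = k * τ ^ 2) :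
    Pi.single m t ∈ Theta p k τ := by
  constructor
  · refine le_trans (Finset.card_le_one.2 fun a ha b hb => ?_) hk
    simp only [Finset.mem_filter, Finset.mem_univ, true_and, Pi.single_apply, ne_eq,
      ite_eq_right_iff, not_forall] at ha hb
    rw [ha.1, hb.1]
  · simp only [Pi.single_apply, ite_pow, ne_eq, OfNat.ofNat_ne_zero, not_false_eq_true, zero_pow,
      Finset.sum_ite_eq', Finset.mem_univ, if_true]
    exact ht.le

/-- Worst-case risk bound over `Θ(k, τ)` for any estimator linear in the response, obtained by
averaging over the signals `± √k τ eₘ`. -/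
theorem le_iSup_risk_of_linear {n p k : ℕ} {τ σ : ℝ} (hk : 0 < k) (hp : 0 < p) (hσ : 0 < σ)
    {est : (Fin n → Fin p → ℝ) × (Fin n → ℝ) → Fin p → ℝ}
    {M : (Fin n → Fin p → ℝ) → Matrix (Fin p) (Fin n) ℝ}
    (hM : ∀ j i, Measurable fun X => M X j i) (hest : ∀ ω, est ω = M ω.1 *ᵥ ω.2) :
    ENNReal.ofReal (k * τ ^ 2) ≤ (⨆ β ∈ Theta p k τ, risk n p σ est β)
      + ENNReal.ofReal ((k * τ ^ 2) ^ 2 / (p * σ ^ 2)) := by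
  set K : ℝ := k * τ ^ 2
  have hK : 0 ≤ K := by positivity
  have hp' : (0 : ℝ) < p := by exact_mod_cast hp
  set v : ℝ := p * σ ^ 2
  have hv : 0 < v := by positivity
  set t := Real.sqrt K
  have ht : t ^ 2 = K := Real.sq_sqrt hK
  set S := ⨆ β ∈ Theta p k τ, risk n p σ est β
  have hrisk : ∀ β, risk n p σ est β
      = ∫⁻ ω, ENNReal.ofReal (linearLoss (M ω.1) ω.1 σ β ω.2) ∂model n p := by
    intro β
    simp only [risk, hest, linearLoss]
  have hnn : ∀ β (ω : (Fin n → Fin p → ℝ) × (Fin n → ℝ)),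
      0 ≤ linearLoss (M ω.1) ω.1 σ β ω.2 := fun β ω => Finset.sum_nonneg fun j _ => sq_nonneg _
  have hmeas : ∀ β, Measurable fun ω : (Fin n → Fin p → ℝ) × (Fin n → ℝ) =>
      ENNReal.ofReal (linearLoss (M ω.1) ω.1 σ β ω.2) := fun β =>
    (measurable_linearLoss hM σ β).ennreal_ofReal
  have hupper : ∑ m : Fin p, (risk n p σ est (Pi.single m t) + risk n p σ est (Pi.single m (-t)))
      ≤ 2 * p * S := by
    have hle : ∀ β ∈ Theta p k τ, risk n p σ est β ≤ S := fun β hβ => le_iSup₂_of_le β hβ le_rfl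
    calc _ ≤ ∑ m : Fin p, (S + S) := Finset.sum_le_sum fun m _ => add_le_add
            (hle _ (single_mem_Theta hk m ht))
            (hle _ (single_mem_Theta hk m (by rw [neg_sq, ht])))
      _ = _ := by
        simp only [Finset.sum_const, Finset.card_univ, Fintype.card_fin, nsmul_eq_mul]
        ring
  have hsum : ∑ m : Fin p, (risk n p σ est (Pi.single m t) + risk n p σ est (Pi.single m (-t)))
      = ∫⁻ X, ∫⁻ z, ENNReal.ofReal (2 * (K * ∑ m, ∑ j, (M X * Matrix.of X - 1 : Matrix (Fin p) (Fin p) ℝ) j m ^ 2)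
          + 2 * v * ∑ j, (∑ i, M X j i * z i) ^ 2)
        ∂(Measure.pi fun _ : Fin n => gaussianReal 0 1)
        ∂(Measure.pi fun _ : Fin n => Measure.pi fun _ : Fin p => gaussianReal 0 (n : ℝ≥0)⁻¹) := by
    simp only [hrisk]
    simp_rw [← lintegral_add_left (hmeas _)]
    have hpair : ∀ m : Fin p, Measurable fun ω : (Fin n → Fin p → ℝ) × (Fin n → ℝ) =>
        ENNReal.ofReal (linearLoss (M ω.1) ω.1 σ (Pi.single m t) ω.2)
          + ENNReal.ofReal (linearLoss (M ω.1) ω.1 σ (Pi.single m (-t)) ω.2) := fun m =>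
      (hmeas _).add (hmeas _)
    rw [← lintegral_finsetSum _ fun m _ => hpair m, model, lintegral_prod _
      (Finset.measurable_sum _ fun m _ => hpair m).aemeasurable]
    refine lintegral_congr fun X => lintegral_congr fun z => ?_
    rw [← ht, ← sum_linearLoss_single_add_neg, ENNReal.ofReal_sum_of_nonneg
      fun m _ => add_nonneg (hnn _ (X, z)) (hnn _ (X, z))]
    exact Finset.sum_congr rfl fun m _ =>
      (ENNReal.ofReal_add (hnn _ (X, z)) (hnn _ (X, z))).symm
  have hinner : ∀ X : Fin n → Fin p → ℝ,
      ∫⁻ z, ENNReal.ofReal (2 * (K * ∑ m, ∑ j, (M X * Matrix.of X - 1 : Matrix (Fin p) (Fin p) ℝ) j m ^ 2)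
          + 2 * v * ∑ j, (∑ i, M X j i * z i) ^ 2)
        ∂(Measure.pi fun _ : Fin n => gaussianReal 0 1)
      = ENNReal.ofReal (2 * (K * ∑ m, ∑ j, (M X * Matrix.of X - 1 : Matrix (Fin p) (Fin p) ℝ) j m ^ 2)
          + 2 * v * ∑ j, ∑ i, M X j i ^ 2) := by
    intro X
    have hint : Integrable (fun z : Fin n → ℝ => 2 * v * ∑ j, (∑ i, M X j i * z i) ^ 2)
        (Measure.pi fun _ : Fin n => gaussianReal 0 1) :=
      (integrable_finsetSum _ fun j _ => integrable_sq_linear_gaussian (M X j)).const_mul _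
    have hadd : Integrable (fun z : Fin n → ℝ =>
        2 * (K * ∑ m, ∑ j, (M X * Matrix.of X - 1 : Matrix (Fin p) (Fin p) ℝ) j m ^ 2)
          + 2 * v * ∑ j, (∑ i, M X j i * z i) ^ 2)
        (Measure.pi fun _ : Fin n => gaussianReal 0 1) := (integrable_const _).add hint
    rw [← ofReal_integral_eq_lintegral_ofReal hadd
      (ae_of_all _ fun z => by positivity), integral_add (integrable_const _) hint,
      integral_const_mul (2 * v),
      integral_finsetSum _ fun j _ => integrable_sq_linear_gaussian (M X j)]
    simp_rw [integral_sq_linear_gaussian]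
    simp
  simp only [hsum, hinner] at hupper
  have hlower : ENNReal.ofReal (2 * (K * p)) ≤ 2 * p * S + ENNReal.ofReal (2 * (K ^ 2 / v) * p) := by
    calc ENNReal.ofReal (2 * (K * p))
        = ∫⁻ _X : Fin n → Fin p → ℝ, ENNReal.ofReal (2 * (K * p)) ∂(Measure.pi fun _ : Fin n =>
          Measure.pi fun _ : Fin p => gaussianReal 0 (n : ℝ≥0)⁻¹) := by simp
      _ ≤ ∫⁻ X : Fin n → Fin p → ℝ,
            (ENNReal.ofReal (2 * (K * ∑ m, ∑ j, (M X * Matrix.of X - 1 : Matrix (Fin p) (Fin p) ℝ) j m ^ 2)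
              + 2 * v * ∑ j, ∑ i, M X j i ^ 2)
            + ENNReal.ofReal (2 * (K ^ 2 / v) * ∑ i, ∑ j, X i j ^ 2)) ∂(Measure.pi fun _ : Fin n =>
          Measure.pi fun _ : Fin p => gaussianReal 0 (n : ℝ≥0)⁻¹) := by
          refine lintegral_mono fun X => ?_
          rw [← ENNReal.ofReal_add (by positivity) (by positivity)]
          apply ENNReal.ofReal_le_ofReal
          linarith [frobenius_bias_variance_lower_bound (M X) X hK hv]
      _ ≤ _ := by
          rw [lintegral_add_right _ (by fun_prop)]
          exact add_le_add hupper (lintegral_frobenius_design_le n p (by positivity))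
  have h2p : ENNReal.ofReal (2 * p) ≠ 0 := by
    simp only [ne_eq, ENNReal.ofReal_eq_zero, not_le]
    positivity
  rw [← ENNReal.mul_le_mul_iff_right h2p ENNReal.ofReal_ne_top, mul_add,
    ← ENNReal.ofReal_mul (by positivity), ← ENNReal.ofReal_mul (by positivity)]
  convert hlower using 2
  · ring
  · rw [ENNReal.ofReal_mul (by norm_num)]
    simp
  · congr 1
    ring

section Ridge

variable {n p : ℕ} {lam : ℝ}

lemma isUnit_det_ridge (hlam : 0 < lam) (X : Matrix (Fin n) (Fin p) ℝ) :
    IsUnit (Xᵀ * X + lam • (1 : Matrix (Fin p) (Fin p) ℝ)).det := by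
  have h1 : (Xᵀ * X).PosSemidef := by
    simpa [conjTranspose_eq_transpose_of_trivial] using posSemidef_conjTranspose_mul_self X
  exact (PosDef.posSemidef_add h1 (PosDef.one.smul hlam)).det_pos.ne'.isUnit

lemma measurable_ridge_entry (lam : ℝ) (j : Fin p) (i : Fin n) :
    Measurable fun X : Fin n → Fin p → ℝ =>
      (((Matrix.of X)ᵀ * Matrix.of X + lam • (1 : Matrix (Fin p) (Fin p) ℝ))⁻¹ *
        (Matrix.of X)ᵀ) j i := by
  have hX : Continuous fun X : Fin n → Fin p → ℝ => (Matrix.of X : Matrix (Fin n) (Fin p) ℝ) :=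
    continuous_id
  have hA : Continuous fun X : Fin n → Fin p → ℝ =>
      (Matrix.of X)ᵀ * Matrix.of X + lam • (1 : Matrix (Fin p) (Fin p) ℝ) :=
    (hX.matrix_transpose.matrix_mul hX).add continuous_const
  simp only [Matrix.mul_apply, Matrix.inv_def, Matrix.smul_apply, Ring.inverse_eq_inv', smul_eq_mul]
  refine Finset.measurable_sum _ fun l _ => ?_
  exact (hA.matrix_det.measurable.inv.mul (hA.matrix_adjugate.matrix_elem j l).measurable).mul
    (hX.matrix_elem i l).measurable

/-- Deterministic error bound for ridge regression with response `X β + w`. -/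
lemma ridge_error_bound (hlam : 0 < lam) (X : Matrix (Fin n) (Fin p) ℝ) (β : Fin p → ℝ)
    (w : Fin n → ℝ) :
    ∑ j, (((Xᵀ * X + lam • (1 : Matrix (Fin p) (Fin p) ℝ))⁻¹ *ᵥ (Xᵀ *ᵥ (X *ᵥ β + w))) j - β j) ^ 2
      ≤ (∑ i, w i ^ 2) / (2 * lam) + ∑ j, β j ^ 2 := by
  set A := Xᵀ * X + lam • (1 : Matrix (Fin p) (Fin p) ℝ) with hA
  set b := A⁻¹ *ᵥ (Xᵀ *ᵥ (X *ᵥ β + w)) with hb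
  set e : Fin p → ℝ := b - β with he
  have hAb : A *ᵥ b = Xᵀ *ᵥ (X *ᵥ β + w) := by
    rw [hb, mulVec_mulVec, Matrix.mul_nonsing_inv _ (isUnit_det_ridge hlam X), one_mulVec]
  have hAe : Xᵀ *ᵥ (X *ᵥ e) + lam • e = Xᵀ *ᵥ w - lam • β := by
    have h : A *ᵥ e = Xᵀ *ᵥ (X *ᵥ β + w) - A *ᵥ β := by rw [he, mulVec_sub, hAb]
    simp only [hA, add_mulVec, smul_mulVec, one_mulVec, ← mulVec_mulVec, mulVec_add] at h
    rw [h]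
    abel
  have hdot : (X *ᵥ e) ⬝ᵥ (X *ᵥ e) + lam * (e ⬝ᵥ e) = (X *ᵥ e) ⬝ᵥ w - lam * (e ⬝ᵥ β) := by
    have h := congrArg (fun u => e ⬝ᵥ u) hAe
    simp only [dotProduct_add, dotProduct_sub, dotProduct_smul, smul_eq_mul, dotProduct_mulVec,
      vecMul_transpose] at h
    simpa only [dotProduct_mulVec] using h
  have h1 : (X *ᵥ e) ⬝ᵥ w ≤ (X *ᵥ e) ⬝ᵥ (X *ᵥ e) + (∑ i, w i ^ 2) / 4 := by
    simp only [dotProduct, Finset.sum_div, ← Finset.sum_add_distrib]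
    refine Finset.sum_le_sum fun i _ => ?_
    nlinarith [sq_nonneg ((X *ᵥ e) i - w i / 2)]
  have h2 : -(e ⬝ᵥ β) ≤ (e ⬝ᵥ e) / 2 + (∑ j, β j ^ 2) / 2 := by
    simp only [dotProduct, Finset.sum_div, ← Finset.sum_add_distrib, ← Finset.sum_neg_distrib]
    refine Finset.sum_le_sum fun j _ => ?_
    nlinarith [sq_nonneg (e j + β j)]
  have h3 : ∑ j, (b j - β j) ^ 2 = e ⬝ᵥ e := by
    simp only [dotProduct, he, Pi.sub_apply, sq]
  rw [h3]
  have h4 : lam * (e ⬝ᵥ e) ≤ (∑ i, w i ^ 2) / 2 + lam * ∑ j, β j ^ 2 := by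
    nlinarith [mul_le_mul_of_nonneg_left h2 hlam.le]
  have h5 : (∑ i, w i ^ 2) / (2 * lam) + ∑ j, β j ^ 2
      = ((∑ i, w i ^ 2) / 2 + lam * ∑ j, β j ^ 2) / lam := by
    field_simp
  rw [h5, le_div_iff₀ hlam, mul_comm]
  exact h4

lemma iSup_risk_ridge_ne_top (hlam : 0 < lam) (k : ℕ) (τ σ : ℝ) :
    (⨆ β ∈ Theta p k τ, risk n p σ (ridgeEst n p lam) β) ≠ ⊤ := by
  have hint : Integrable (fun z : Fin n → ℝ => (∑ i, (σ * z i) ^ 2) / (2 * lam) + k * τ ^ 2)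
      (Measure.pi fun _ : Fin n => gaussianReal 0 1) := by
    refine Integrable.add (Integrable.div_const (integrable_finsetSum _ fun i _ => ?_) _)
      (integrable_const _)
    simpa [Pi.single_apply] using integrable_sq_linear_gaussian (Pi.single i σ)
  have hfin : ∫⁻ ω : (Fin n → Fin p → ℝ) × (Fin n → ℝ),
      ENNReal.ofReal ((∑ i, (σ * ω.2 i) ^ 2) / (2 * lam) + k * τ ^ 2) ∂model n p ≠ ⊤ :=
    (hint.comp_snd (Measure.pi fun _ : Fin n => Measure.pi fun _ : Fin p =>
      gaussianReal 0 (n : ℝ≥0)⁻¹)).lintegral_lt_top.ne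
  refine ne_top_of_le_ne_top hfin (iSup₂_le fun β hβ => lintegral_mono fun ω =>
    ENNReal.ofReal_le_ofReal ?_)
  exact (ridge_error_bound hlam (Matrix.of ω.1) β fun i => σ * ω.2 i).trans
    (add_le_add le_rfl hβ.2)

theorem le_toReal_iInf_risk_ridge (n : ℕ) {k p : ℕ} {τ σ : ℝ} (hk : 0 < k) (hp : 0 < p)
    (hσ : 0 < σ) :
    k * τ ^ 2 - (k * τ ^ 2) ^ 2 / (p * σ ^ 2)
      ≤ (⨅ (lam : ℝ) (_ : 0 < lam),
          ⨆ β ∈ Theta p k τ, risk n p σ (ridgeEst n p lam) β).toReal := by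
  have hne : (⨅ (lam : ℝ) (_ : 0 < lam),
      ⨆ β ∈ Theta p k τ, risk n p σ (ridgeEst n p lam) β) ≠ ⊤ :=
    ne_top_of_le_ne_top (iSup_risk_ridge_ne_top one_pos k τ σ) (iInf₂_le 1 one_pos)
  rw [← ENNReal.ofReal_le_iff_le_toReal hne, ENNReal.ofReal_sub _ (by positivity)]
  refine le_iInf₂ fun lam hlam => tsub_le_iff_right.2 ?_
  exact le_iSup_risk_of_linear hk hp hσ (measurable_ridge_entry lam) fun ω => by
    rw [ridgeEst, mulVec_mulVec]

end Ridge

/-- **Proposition 2 (suboptimality of ridge in Regime II).** If `k/p → 0`,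
`μ = τ/σ → ∞`, `μ = o(√(log(p/k)))` and `(k log(p/k))/n → 0`, then the optimally tuned
ridge estimator satisfies
`inf_{λ>0} sup_{Θ(k,τ)} E‖β̂^R(λ) − β‖² ≥ k τ² (1 − (k τ²/(p σ²))(1 + o(1)))`, i.e.
`limsup (1 − I_n/(k τ²)) · (p σ²/(k τ²)) ≤ 1` where `I_n` is the optimally tuned
worst-case ridge risk. -/
theorem ridge_suboptimal_regimeII
    (k p : ℕ → ℕ) (τ σ : ℕ → ℝ)
    (hk : ∀ n, 0 < k n) (hkp : ∀ n, k n ≤ p n)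
    (hτ : ∀ n, 0 < τ n) (hσ : ∀ n, 0 < σ n)
    (hkp0 : Tendsto (fun n => (k n : ℝ) / p n) atTop (nhds 0))
    (hμ : Tendsto (fun n => τ n / σ n) atTop atTop)
    (hμo : Tendsto (fun n => (τ n / σ n) / Real.sqrt (Real.log ((p n : ℝ) / k n)))
      atTop (nhds 0))
    (hklog : Tendsto (fun n => (k n : ℝ) * Real.log ((p n : ℝ) / k n) / n)
      atTop (nhds 0)) :
    Filter.limsup (fun n =>
        (1 - (⨅ (lam : ℝ) (_ : 0 < lam),
            ⨆ β ∈ Theta (p n) (k n) (τ n),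
              risk n (p n) (σ n) (ridgeEst n (p n) lam) β).toReal / (k n * τ n ^ 2)) *
          ((p n * σ n ^ 2) / (k n * τ n ^ 2))) atTop ≤ 1 := by
  have hle : ∀ n, (1 - (⨅ (lam : ℝ) (_ : 0 < lam),
            ⨆ β ∈ Theta (p n) (k n) (τ n),
              risk n (p n) (σ n) (ridgeEst n (p n) lam) β).toReal / (k n * τ n ^ 2)) *
          ((p n * σ n ^ 2) / (k n * τ n ^ 2)) ≤ 1 := by
    intro n
    have hp := (hk n).trans_le (hkp n)
    have h := le_toReal_iInf_risk_ridge n (τ := τ n) (hk n) hp (hσ n)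
    set I := (⨅ (lam : ℝ) (_ : 0 < lam),
      ⨆ β ∈ Theta (p n) (k n) (τ n), risk n (p n) (σ n) (ridgeEst n (p n) lam) β).toReal
    have hK : (0 : ℝ) < k n * τ n ^ 2 :=
      mul_pos (by exact_mod_cast hk n) (pow_pos (hτ n) 2)
    have hv : (0 : ℝ) < p n * σ n ^ 2 :=
      mul_pos (by exact_mod_cast hp) (pow_pos (hσ n) 2)
    generalize (k n * τ n ^ 2 : ℝ) = K at h hK ⊢
    generalize (p n * σ n ^ 2 : ℝ) = v at h hv ⊢
    rw [one_sub_div hK.ne', div_mul_div_comm, div_le_one (by positivity)]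
    have h' : (K - I) * v ≤ K ^ 2 / v * v :=
      mul_le_mul_of_nonneg_right (by linarith) hv.le
    rw [div_mul_cancel₀ _ hv.ne'] at h'
    linarith [sq K]
  rw [limsup_eq]
  by_cases hb : BddBelow {a | ∀ᶠ n in atTop, (1 - (⨅ (lam : ℝ) (_ : 0 < lam),
            ⨆ β ∈ Theta (p n) (k n) (τ n),
              risk n (p n) (σ n) (ridgeEst n (p n) lam) β).toReal / (k n * τ n ^ 2)) *
          ((p n * σ n ^ 2) / (k n * τ n ^ 2)) ≤ a}
  · exact csInf_le hb (Eventually.of_forall hle)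
  · rw [Real.sInf_of_not_bddBelow hb]
    exact zero_le_one
end
end

section
/- Consider the linear regression model y = Xβ + z with σ = 1 and β ∈ ℝ^m, where the columns of X ∈ ℝ^{n×m} scaled by √n and z ∈ ℝ^n are i.i.d. standard Gaussian. Let π = π_S(λ; m) be the single spike prior and β̂_π the Bayesian estimator under π. Suppose m → ∞ and (log m)/n → 0. If λ > 0 and λ² ≤ (2−δ)·log m for a fixed constant δ ∈ (0,1), then E_π‖β̂_π − β‖₂² ≥ λ²·(1+o(1)); equivalently, liminf_n E_π‖β̂_π − β‖₂² / λ² ≥ 1. -/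
open MeasureTheory ProbabilityTheory Filter
open scoped NNReal ENNReal

noncomputable section

/-- Sample space for the Bayesian model with single spike prior: a design matrix
`X ∈ ℝ^{n×m}`, a noise vector `z ∈ ℝ^n`, and a spike location `I ∈ [m]`. -/
abbrev SpikeOmega (n m : ℕ) : Type :=
  ((Fin n → Fin m → ℝ) × (Fin n → ℝ)) × Fin m

/-- The joint law: design entries i.i.d. `N(0, 1/n)`, noise entries i.i.d. `N(0,1)`,
and an independent uniformly random spike location in `[m]`. -/
def spikeLaw (n m : ℕ) : Measure (SpikeOmega n m) :=
  ((Measure.pi fun _ : Fin n => Measure.pi fun _ : Fin m => gaussianReal 0 (n : ℝ≥0)⁻¹).prod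
    (Measure.pi fun _ : Fin n => gaussianReal 0 1)).prod
    (((m : ℝ≥0∞))⁻¹ • Measure.count)

/-- The signal drawn from the single spike prior `π_S(λ; m)`: `β = λ e_I`. -/
def spikeSignal (m : ℕ) (lam : ℝ) (I : Fin m) : Fin m → ℝ :=
  fun j => if j = I then lam else 0

/-- The observed data `(X, y)` with `y = X β + z`. -/
def spikeData (n m : ℕ) (lam : ℝ) (ω : SpikeOmega n m) :
    (Fin n → Fin m → ℝ) × (Fin n → ℝ) :=
  (ω.1.1, fun i => (∑ j, ω.1.1 i j * spikeSignal m lam ω.2 j) + ω.1.2 i)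

/-- Coordinate `j` of the Bayesian estimator (posterior mean) `β̂_π = E_π(β | y, X)`:
the conditional expectation of `β_j` given the σ-algebra generated by the data. -/
def spikePostMean (n m : ℕ) (lam : ℝ) (j : Fin m) : SpikeOmega n m → ℝ :=
  (spikeLaw n m)[fun ω => spikeSignal m lam ω.2 j |
    MeasurableSpace.comap (spikeData n m lam) inferInstance]

/-- The Bayes risk `E_π ‖β̂_π − β‖₂²` of the posterior mean under the single spike
prior. -/
def spikeBayesRisk (n m : ℕ) (lam : ℝ) : ℝ :=
  ∫ ω, ∑ j, (spikePostMean n m lam j ω - spikeSignal m lam ω.2 j) ^ 2 ∂ spikeLaw n m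

theorem lintegral_pi_prod {ι : Type*} [Fintype ι] {Ω : ι → Type*} [∀ i, MeasurableSpace (Ω i)]
    (μ : ∀ i, Measure (Ω i)) [∀ i, IsProbabilityMeasure (μ i)] {f : ∀ i, Ω i → ℝ≥0∞}
    (hf : ∀ i, Measurable (f i)) :
    ∫⁻ x, ∏ i, f i (x i) ∂Measure.pi μ = ∏ i, ∫⁻ x, f i x ∂μ i := by
  have hind : iIndepFun (fun i (x : ∀ i, Ω i) => f i (x i)) (Measure.pi μ) :=
    iIndepFun_pi fun i => (hf i).aemeasurable
  have h := lintegral_prod_eq_prod_lintegral_of_indepFun Finset.univ _ hind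
    fun i => (hf i).comp (measurable_pi_apply i)
  refine h.trans (Finset.prod_congr rfl fun i _ => ?_)
  exact (measurePreserving_eval μ i).lintegral_comp (hf i)

theorem pi_withDensity {ι : Type*} [Fintype ι] {Ω : ι → Type*} [∀ i, MeasurableSpace (Ω i)]
    (μ : ∀ i, Measure (Ω i)) [∀ i, IsProbabilityMeasure (μ i)] {f : ∀ i, Ω i → ℝ≥0∞}
    (hf : ∀ i, Measurable (f i)) [∀ i, SigmaFinite ((μ i).withDensity (f i))] :
    Measure.pi (fun i => (μ i).withDensity (f i)) =
      (Measure.pi μ).withDensity fun x => ∏ i, f i (x i) := by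
  refine Measure.pi_eq fun s hs => ?_
  rw [withDensity_apply _ (MeasurableSet.univ_pi hs),
    ← lintegral_indicator (MeasurableSet.univ_pi hs)]
  have hprod : (Set.univ.pi s).indicator (fun x : ∀ i, Ω i => ∏ i, f i (x i)) =
      fun x => ∏ i, (s i).indicator (f i) (x i) := by
    ext x
    by_cases hx : x ∈ Set.univ.pi s
    · rw [Set.indicator_of_mem hx]
      exact Finset.prod_congr rfl fun i _ => (Set.indicator_of_mem (hx i (Set.mem_univ i)) _).symm
    · rw [Set.indicator_of_notMem hx]
      simp only [Set.mem_univ_pi, not_forall] at hx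
      obtain ⟨i, hi⟩ := hx
      exact (Finset.prod_eq_zero (Finset.mem_univ i) (Set.indicator_of_notMem hi _)).symm
  rw [hprod, lintegral_pi_prod μ fun i => (hf i).indicator (hs i)]
  refine Finset.prod_congr rfl fun i _ => ?_
  rw [lintegral_indicator (hs i), withDensity_apply _ (hs i)]

theorem gaussianReal_one_eq_withDensity (a : ℝ) :
    gaussianReal a 1 =
      (gaussianReal 0 1).withDensity fun x => ENNReal.ofReal (Real.exp (a * x - a ^ 2 / 2)) := by
  rw [gaussianReal_of_var_ne_zero a one_ne_zero, gaussianReal_of_var_ne_zero 0 one_ne_zero,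
    ← withDensity_mul _ (measurable_gaussianPDF 0 1) (by fun_prop)]
  congr 1
  ext x
  simp only [gaussianPDF, Pi.mul_apply, gaussianPDFReal]
  rw [← ENNReal.ofReal_mul (by positivity)]
  rw [mul_assoc _ (Real.exp _), ← Real.exp_add]
  congr 3
  simp
  ring

/-- Cameron–Martin formula for the standard Gaussian measure on `ℝ^ι`. -/
theorem lintegral_gaussian_shift {ι : Type*} [Fintype ι] (a : ι → ℝ) {φ : (ι → ℝ) → ℝ≥0∞}
    (hφ : Measurable φ) :
    ∫⁻ z, φ (fun i => a i + z i) ∂Measure.pi (fun _ => gaussianReal 0 1) =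
      ∫⁻ z, ENNReal.ofReal (Real.exp (∑ i, (a i * z i - a i ^ 2 / 2))) * φ z
        ∂Measure.pi (fun _ => gaussianReal 0 1) := by
  have hmap : (Measure.pi fun _ : ι => gaussianReal 0 1).map (fun z i => a i + z i) =
      Measure.pi fun i => gaussianReal (a i) 1 := by
    rw [Measure.pi_map_pi (f := fun i x => a i + x) fun i => by fun_prop]
    simp [gaussianReal_map_const_add]
  have hshift : (Measure.pi fun _ : ι => gaussianReal 0 1).map (fun z i => a i + z i) =
      (Measure.pi fun _ : ι => gaussianReal 0 1).withDensity
        fun z => ∏ i, ENNReal.ofReal (Real.exp (a i * z i - a i ^ 2 / 2)) := by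
    have : ∀ i, SigmaFinite ((gaussianReal 0 1).withDensity
        fun x => ENNReal.ofReal (Real.exp (a i * x - a i ^ 2 / 2))) := fun i => by
      rw [← gaussianReal_one_eq_withDensity]; infer_instance
    rw [hmap, ← pi_withDensity (fun _ : ι => gaussianReal 0 1)
      (f := fun i x => ENNReal.ofReal (Real.exp (a i * x - a i ^ 2 / 2))) fun i => by fun_prop]
    congr 1
    ext1 i
    exact gaussianReal_one_eq_withDensity (a i)
  rw [← lintegral_map hφ (by fun_prop), hshift,
    lintegral_withDensity_eq_lintegral_mul _ (by fun_prop) hφ]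
  refine lintegral_congr fun z => ?_
  rw [Pi.mul_apply, Real.exp_sum, ENNReal.ofReal_prod_of_nonneg fun i _ => (Real.exp_pos _).le]

theorem gaussian_inner_tail {ι : Type*} [Fintype ι] (a : ι → ℝ) {s : ℝ} (hs : 0 < s) :
    Measure.pi (fun _ : ι => gaussianReal 0 1) {z | s ≤ ∑ i, a i * z i} ≤
      ENNReal.ofReal ((∑ i, a i ^ 2) / s ^ 2) := by
  have hmem : ∀ i, MemLp (fun x => a i * x) 2 (gaussianReal 0 1) := fun i =>
    (memLp_id_gaussianReal 2).const_mul (a i)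
  have hmem' : ∀ i, MemLp (fun z : ι → ℝ => a i * z i) 2
      (Measure.pi fun _ : ι => gaussianReal 0 1) := fun i =>
    (hmem i).comp_measurePreserving (measurePreserving_eval (fun _ : ι => gaussianReal 0 1) i)
  have hvar := variance_sum_pi (μ := fun _ : ι => gaussianReal 0 1) (X := fun i x => a i * x) hmem
  have hvar_i : ∀ i, Var[fun x => a i * x; gaussianReal 0 1] = a i ^ 2 := fun i => by
    rw [variance_const_mul, variance_fun_id_gaussianReal]; simp
  have hmean : ∫ z, (∑ i, fun z : ι → ℝ => a i * z i) z
      ∂Measure.pi (fun _ : ι => gaussianReal 0 1) = 0 := by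
    simp only [Finset.sum_apply]
    rw [integral_finsetSum _ fun i _ => (hmem' i).integrable one_le_two]
    refine Finset.sum_eq_zero fun i _ => ?_
    rw [integral_const_mul]
    have hi := integral_comp_eval (μ := fun _ : ι => gaussianReal 0 1) (i := i)
      (f := fun x => x) aestronglyMeasurable_id
    rw [hi, integral_id_gaussianReal, mul_zero]
  have h := meas_ge_le_variance_div_sq (memLp_finsetSum' Finset.univ fun i _ => hmem' i) hs
  rw [hvar] at h
  simp_rw [hvar_i, hmean] at h
  refine (measure_mono fun z hz => ?_).trans h
  simp only [Set.mem_ofPred_eq, Finset.sum_apply, sub_zero] at hz ⊢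
  exact hz.trans (le_abs_self _)

/-- Truncated change of measure: a function bounded by `c` has shifted Gaussian integral at most
`exp t` times the unshifted one, up to the probability that the log-likelihood exceeds `t`. -/
theorem lintegral_gaussian_shift_le {ι : Type*} [Fintype ι] (a : ι → ℝ) {φ : (ι → ℝ) → ℝ≥0∞}
    (hφ : Measurable φ) {c : ℝ≥0∞} (hc : ∀ z, φ z ≤ c) (t : ℝ) {s : ℝ} (hs : 0 < s) :
    ∫⁻ z, φ (fun i => a i + z i) ∂Measure.pi (fun _ => gaussianReal 0 1) ≤
      ENNReal.ofReal (Real.exp t) * ∫⁻ z, φ z ∂Measure.pi (fun _ => gaussianReal 0 1) +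
        c * ({b : ι → ℝ | t - s ≤ (∑ i, b i ^ 2) / 2}.indicator 1 a +
          ENNReal.ofReal ((∑ i, a i ^ 2) / s ^ 2)) := by
  set γ := Measure.pi fun _ : ι => gaussianReal 0 1
  set ℓ : (ι → ℝ) → ℝ := fun z => ∑ i, (a i * z i - a i ^ 2 / 2)
  have hℓ : Measurable ℓ := by fun_prop
  have hset : MeasurableSet {z | ℓ z ≤ t} := measurableSet_le hℓ measurable_const
  have hset' : MeasurableSet {z : ι → ℝ | t < ℓ fun i => a i + z i} :=
    measurableSet_lt measurable_const (hℓ.comp (by fun_prop))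
  have hsplit : ∀ z : ι → ℝ, φ (fun i => a i + z i) ≤
      {z | ℓ z ≤ t}.indicator φ (fun i => a i + z i) +
        {z : ι → ℝ | t < ℓ fun i => a i + z i}.indicator (fun _ => c) z := fun z => by
    rcases le_or_gt (ℓ fun i => a i + z i) t with h | h
    · rw [Set.indicator_of_mem (show (fun i => a i + z i) ∈ {z | ℓ z ≤ t} from h)]
      exact le_self_add
    · rw [Set.indicator_of_mem (show z ∈ {z : ι → ℝ | t < ℓ fun i => a i + z i} from h)]
      exact (hc _).trans le_add_self
  have hmain : ∫⁻ z, {z | ℓ z ≤ t}.indicator φ (fun i => a i + z i) ∂γ ≤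
      ENNReal.ofReal (Real.exp t) * ∫⁻ z, φ z ∂γ := by
    rw [lintegral_gaussian_shift a (hφ.indicator hset), ← lintegral_const_mul _ hφ]
    refine lintegral_mono fun z => ?_
    by_cases hz : ℓ z ≤ t
    · rw [Set.indicator_of_mem (show z ∈ {z | ℓ z ≤ t} from hz)]
      gcongr
    · rw [Set.indicator_of_notMem (show z ∉ {z | ℓ z ≤ t} from hz), mul_zero]
      exact zero_le
  have htail : γ {z : ι → ℝ | t < ℓ fun i => a i + z i} ≤
      {b : ι → ℝ | t - s ≤ (∑ i, b i ^ 2) / 2}.indicator 1 a +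
        ENNReal.ofReal ((∑ i, a i ^ 2) / s ^ 2) := by
    by_cases ha : t - s ≤ (∑ i, a i ^ 2) / 2
    · rw [Set.indicator_of_mem (show a ∈ {b : ι → ℝ | t - s ≤ (∑ i, b i ^ 2) / 2} from ha)]
      exact prob_le_one.trans le_self_add
    · refine le_trans (measure_mono fun z hz => ?_)
        ((gaussian_inner_tail a hs).trans le_add_self)
      have hz' : ℓ (fun i => a i + z i) = ∑ i, a i * z i + (∑ i, a i ^ 2) / 2 := by
        simp only [ℓ, Finset.sum_div, ← Finset.sum_add_distrib]
        exact Finset.sum_congr rfl fun i _ => by ring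
      simp only [Set.mem_ofPred_eq, hz'] at hz ⊢
      linarith
  calc ∫⁻ z, φ (fun i => a i + z i) ∂γ
      ≤ ∫⁻ z, ({z | ℓ z ≤ t}.indicator φ (fun i => a i + z i) +
        {z : ι → ℝ | t < ℓ fun i => a i + z i}.indicator (fun _ => c) z) ∂γ :=
        lintegral_mono hsplit
    _ = ∫⁻ z, {z | ℓ z ≤ t}.indicator φ (fun i => a i + z i) ∂γ +
        c * γ {z : ι → ℝ | t < ℓ fun i => a i + z i} := by
        rw [lintegral_add_right _ (measurable_const.indicator hset'),
          lintegral_indicator_const hset']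
    _ ≤ _ := by gcongr

theorem variance_sq_gaussianReal (v : ℝ≥0) :
    Var[fun x => x ^ 2; gaussianReal 0 v] =
      (v : ℝ) ^ 2 * Var[fun x => x ^ 2; gaussianReal 0 1] := by
  have hmap : gaussianReal 0 v = (gaussianReal 0 1).map fun x => √(v : ℝ) * x := by
    rw [gaussianReal_map_const_mul, mul_zero, mul_one]
    congr 1
    ext
    exact (Real.sq_sqrt v.2).symm
  rw [hmap, variance_map (by fun_prop) (by fun_prop)]
  have : ((fun x : ℝ => x ^ 2) ∘ fun x => √(v : ℝ) * x) = fun x => (v : ℝ) * x ^ 2 := by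
    ext x
    simp [mul_pow]
  rw [this, variance_const_mul]

theorem integral_sq_gaussianReal (v : ℝ≥0) : ∫ x, x ^ 2 ∂gaussianReal 0 v = v := by
  have h := variance_fun_id_gaussianReal (μ := 0) (v := v)
  rwa [variance_of_integral_eq_zero (by fun_prop) integral_id_gaussianReal] at h

theorem memLp_sq_gaussianReal (v : ℝ≥0) : MemLp (fun x : ℝ => x ^ 2) 2 (gaussianReal 0 v) := by
  have h : MemLp (fun x : ℝ => x) 4 (gaussianReal 0 v) := memLp_id_gaussianReal 4
  have := h.norm_rpow_div 2
  have e : (4 : ℝ≥0∞) / 2 = 2 := by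
    rw [show (4 : ℝ≥0∞) = 2 * 2 by norm_num]
    exact ENNReal.mul_div_cancel_right two_ne_zero ENNReal.ofNat_ne_top
  simpa [e] using this

/-- The columns of the design: entries are i.i.d. `N(0, 1/n)`, so the squared norm of a column
has mean one. -/
theorem integral_column_sq_norm {n m : ℕ} (hn : n ≠ 0) (j : Fin m) :
    Integrable (fun X : Fin n → Fin m → ℝ => ∑ i, X i j ^ 2)
      (Measure.pi fun _ => Measure.pi fun _ => gaussianReal 0 (n : ℝ≥0)⁻¹) ∧
    ∫ X : Fin n → Fin m → ℝ, ∑ i, X i j ^ 2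
      ∂(Measure.pi fun _ => Measure.pi fun _ => gaussianReal 0 (n : ℝ≥0)⁻¹) = 1 := by
  have hmp : ∀ i : Fin n, MeasurePreserving (fun X : Fin n → Fin m → ℝ => X i j)
      (Measure.pi fun _ => Measure.pi fun _ => gaussianReal 0 (n : ℝ≥0)⁻¹)
      (gaussianReal 0 (n : ℝ≥0)⁻¹) := fun i =>
    (measurePreserving_eval (fun _ : Fin m => gaussianReal 0 (n : ℝ≥0)⁻¹) j).comp
      (measurePreserving_eval (fun _ : Fin n =>
        Measure.pi fun _ : Fin m => gaussianReal 0 (n : ℝ≥0)⁻¹) i)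
  have hint : ∀ i : Fin n, Integrable (fun X : Fin n → Fin m → ℝ => X i j ^ 2)
      (Measure.pi fun _ => Measure.pi fun _ => gaussianReal 0 (n : ℝ≥0)⁻¹) := fun i =>
    (hmp i).integrable_comp_of_integrable
      ((memLp_sq_gaussianReal (n : ℝ≥0)⁻¹).integrable one_le_two)
  refine ⟨integrable_finsetSum _ fun i _ => hint i, ?_⟩
  rw [integral_finsetSum _ fun i _ => hint i]
  have hval : ∀ i : Fin n, ∫ X : Fin n → Fin m → ℝ, X i j ^ 2
      ∂(Measure.pi fun _ => Measure.pi fun _ => gaussianReal 0 (n : ℝ≥0)⁻¹) = (n : ℝ)⁻¹ :=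
    fun i => by
    rw [← integral_map (f := fun x : ℝ => x ^ 2) (hmp i).aemeasurable (by fun_prop), (hmp i).map_eq,
      integral_sq_gaussianReal]
    simp
  simp [hval, hn]

theorem column_sq_norm_tail {n m : ℕ} (hn : n ≠ 0) (j : Fin m) {ε : ℝ} (hε : 0 < ε) :
    (Measure.pi fun _ : Fin n => Measure.pi fun _ : Fin m => gaussianReal 0 (n : ℝ≥0)⁻¹)
      {X | 1 + ε ≤ ∑ i, X i j ^ 2} ≤
    ENNReal.ofReal (Var[fun x => x ^ 2; gaussianReal 0 1] / (n * ε ^ 2)) := by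
  have hmp := measurePreserving_eval (fun _ : Fin m => gaussianReal 0 (n : ℝ≥0)⁻¹) j
  have hmem : MemLp (fun x : Fin m → ℝ => x j ^ 2) 2
      (Measure.pi fun _ : Fin m => gaussianReal 0 (n : ℝ≥0)⁻¹) :=
    (memLp_sq_gaussianReal (n : ℝ≥0)⁻¹).comp_measurePreserving hmp
  have hmem' : ∀ i : Fin n, MemLp (fun X : Fin n → Fin m → ℝ => X i j ^ 2) 2
      (Measure.pi fun _ : Fin n => Measure.pi fun _ : Fin m => gaussianReal 0 (n : ℝ≥0)⁻¹) :=
    fun i => hmem.comp_measurePreserving (measurePreserving_eval (fun _ : Fin n =>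
        Measure.pi fun _ : Fin m => gaussianReal 0 (n : ℝ≥0)⁻¹) i)
  have hvar : Var[fun x : Fin m → ℝ => x j ^ 2;
      Measure.pi fun _ : Fin m => gaussianReal 0 (n : ℝ≥0)⁻¹] =
      (n : ℝ)⁻¹ ^ 2 * Var[fun x => x ^ 2; gaussianReal 0 1] := by
    have h := variance_map (μ := Measure.pi fun _ : Fin m => gaussianReal 0 (n : ℝ≥0)⁻¹)
      (X := fun x : ℝ => x ^ 2) (Y := fun x : Fin m → ℝ => x j)
      (by fun_prop) (measurable_pi_apply j).aemeasurable
    have hm : Measure.map (fun x : Fin m → ℝ => x j)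
      (Measure.pi fun _ : Fin m => gaussianReal 0 (n : ℝ≥0)⁻¹) = _ := hmp.map_eq
    rw [hm, variance_sq_gaussianReal] at h
    simpa [Function.comp_def] using h.symm
  have hsum := variance_sum_pi
    (μ := fun _ : Fin n => Measure.pi fun _ : Fin m => gaussianReal 0 (n : ℝ≥0)⁻¹)
    (X := fun _ x => x j ^ 2) fun _ => hmem
  have hmean := (integral_column_sq_norm hn j).2
  have h := meas_ge_le_variance_div_sq (memLp_finsetSum' Finset.univ fun i _ => hmem' i) hε
  rw [hsum] at h
  simp_rw [Finset.sum_apply, hmean, hvar] at h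
  refine (measure_mono fun X hX => ?_).trans (h.trans_eq ?_)
  · simp only [Set.mem_ofPred_eq] at hX ⊢
    exact (by linarith : ε ≤ _).trans (le_abs_self _)
  · congr 1
    have : (n : ℝ) ≠ 0 := by exact_mod_cast hn
    simp
    field_simp

/-- Integrated change of measure: the mean of `k (X, X β + z)` with `β = λ e_j` is compared to that
of `k (X, z)`. -/
theorem lintegral_design_shift_le {n m : ℕ} (hn : n ≠ 0) (j : Fin m) (lam : ℝ)
    {k : (Fin n → Fin m → ℝ) × (Fin n → ℝ) → ℝ≥0∞} (hk : Measurable k) {c : ℝ≥0∞}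
    (hc : ∀ d, k d ≤ c) {t s ε : ℝ} (hs : 0 < s) (hε : 0 < ε) (hlam : 0 < lam)
    (hts : (1 + ε) * lam ^ 2 / 2 ≤ t - s) :
    ∫⁻ p, k (p.1, fun i => p.1 i j * lam + p.2 i)
      ∂((Measure.pi fun _ : Fin n => Measure.pi fun _ : Fin m => gaussianReal 0 (n : ℝ≥0)⁻¹).prod
        (Measure.pi fun _ : Fin n => gaussianReal 0 1)) ≤
    ENNReal.ofReal (Real.exp t) * ∫⁻ p, k p
      ∂((Measure.pi fun _ : Fin n => Measure.pi fun _ : Fin m => gaussianReal 0 (n : ℝ≥0)⁻¹).prod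
        (Measure.pi fun _ : Fin n => gaussianReal 0 1)) +
      c * (ENNReal.ofReal (Var[fun x => x ^ 2; gaussianReal 0 1] / (n * ε ^ 2)) +
        ENNReal.ofReal (lam ^ 2 / s ^ 2)) := by
  rw [lintegral_prod _ (by fun_prop), lintegral_prod _ hk.aemeasurable]
  set μX := Measure.pi fun _ : Fin n => Measure.pi fun _ : Fin m => gaussianReal 0 (n : ℝ≥0)⁻¹
  set γ := Measure.pi fun _ : Fin n => gaussianReal 0 1
  have hB : MeasurableSet {X : Fin n → Fin m → ℝ | 1 + ε ≤ ∑ i, X i j ^ 2} :=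
    measurableSet_le measurable_const (by fun_prop)
  have hsq : ∀ X : Fin n → Fin m → ℝ,
      ∑ i, (X i j * lam) ^ 2 = (∑ i, X i j ^ 2) * lam ^ 2 := fun X => by
    simp only [mul_pow, Finset.sum_mul]
  have hpt : ∀ X : Fin n → Fin m → ℝ, ∫⁻ z, k (X, fun i => X i j * lam + z i) ∂γ ≤
      ENNReal.ofReal (Real.exp t) * ∫⁻ z, k (X, z) ∂γ +
        c * ({X : Fin n → Fin m → ℝ | 1 + ε ≤ ∑ i, X i j ^ 2}.indicator 1 X +
          ENNReal.ofReal ((∑ i, X i j ^ 2) * (lam ^ 2 / s ^ 2))) := fun X => by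
    refine (lintegral_gaussian_shift_le (fun i => X i j * lam) (φ := fun z => k (X, z))
      (hk.comp measurable_prodMk_left) (fun z => hc _) t hs).trans ?_
    rw [hsq, mul_div_assoc]
    gcongr _ + c * (?_ + _)
    by_cases hX : (fun i => X i j * lam) ∈ {b : Fin n → ℝ | t - s ≤ (∑ i, b i ^ 2) / 2}
    · have hX' : X ∈ {X : Fin n → Fin m → ℝ | 1 + ε ≤ ∑ i, X i j ^ 2} := by
        simp only [Set.mem_ofPred_eq, hsq] at hX ⊢
        have : (1 + ε) * lam ^ 2 ≤ (∑ i, X i j ^ 2) * lam ^ 2 := by linarith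
        exact le_of_mul_le_mul_right this (by positivity)
      rw [Set.indicator_of_mem hX, Set.indicator_of_mem hX']
      exact le_rfl
    · rw [Set.indicator_of_notMem hX]
      exact zero_le
  have hmean : ∫⁻ X, ENNReal.ofReal ((∑ i, X i j ^ 2) * (lam ^ 2 / s ^ 2)) ∂μX =
      ENNReal.ofReal (lam ^ 2 / s ^ 2) := by
    obtain ⟨hi, h1⟩ := integral_column_sq_norm (m := m) hn j
    rw [← ofReal_integral_eq_lintegral_ofReal (hi.mul_const _)
      (ae_of_all _ fun X => by positivity), integral_mul_const, h1, one_mul]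
  have hkm : Measurable fun X => ∫⁻ z, k (X, z) ∂γ := hk.lintegral_prod_right'
  refine (lintegral_mono hpt).trans ?_
  have hone : Measurable ({X : Fin n → Fin m → ℝ | 1 + ε ≤ ∑ i, X i j ^ 2}.indicator
      (1 : (Fin n → Fin m → ℝ) → ℝ≥0∞)) := measurable_one.indicator hB
  rw [lintegral_add_left (hkm.const_mul _), lintegral_const_mul _ hkm,
    lintegral_const_mul c (by fun_prop), lintegral_add_left hone,
    lintegral_indicator_one hB, hmean]
  gcongr
  exact column_sq_norm_tail hn j hε

instance isProbabilityMeasure_spikeLaw (n m : ℕ) [NeZero m] :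
    IsProbabilityMeasure (spikeLaw n m) := by
  have : IsProbabilityMeasure (((m : ℝ≥0∞))⁻¹ • (Measure.count : Measure (Fin m))) := ⟨by
    simp [ENNReal.inv_mul_cancel (Nat.cast_ne_zero.2 (NeZero.ne m)) (ENNReal.natCast_ne_top m)]⟩
  unfold spikeLaw
  infer_instance

theorem measurable_spikeSignal (n m : ℕ) (lam : ℝ) (j : Fin m) :
    Measurable fun ω : SpikeOmega n m => spikeSignal m lam ω.2 j :=
  (measurable_of_finite fun I : Fin m => spikeSignal m lam I j).comp measurable_snd

theorem measurable_spikeData (n m : ℕ) (lam : ℝ) : Measurable (spikeData n m lam) := by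
  have := measurable_spikeSignal n m lam
  unfold spikeData
  fun_prop

theorem spikeData_mk {n m : ℕ} (lam : ℝ) (p : (Fin n → Fin m → ℝ) × (Fin n → ℝ)) (j : Fin m) :
    spikeData n m lam (p, j) = (p.1, fun i => p.1 i j * lam + p.2 i) := by
  simp [spikeData, spikeSignal]

theorem lintegral_spikeLaw {n m : ℕ} {F : SpikeOmega n m → ℝ≥0∞} (hF : Measurable F) :
    ∫⁻ ω, F ω ∂spikeLaw n m = (m : ℝ≥0∞)⁻¹ * ∑ j, ∫⁻ p, F (p, j)
      ∂((Measure.pi fun _ : Fin n => Measure.pi fun _ : Fin m => gaussianReal 0 (n : ℝ≥0)⁻¹).prod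
        (Measure.pi fun _ : Fin n => gaussianReal 0 1)) := by
  rw [spikeLaw, lintegral_prod_symm' _ hF, lintegral_smul_measure, lintegral_count, tsum_fintype,
    smul_eq_mul]

theorem integrable_spikeSignal (n m : ℕ) [NeZero m] (lam : ℝ) (j : Fin m) :
    Integrable (fun ω => spikeSignal m lam ω.2 j) (spikeLaw n m) :=
  Integrable.of_bound (measurable_spikeSignal n m lam j).aestronglyMeasurable |lam|
    (ae_of_all _ fun ω => by unfold spikeSignal; split_ifs <;> simp)

theorem spikePostMean_nonneg {n m : ℕ} {lam : ℝ} (hlam : 0 ≤ lam) (j : Fin m) :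
    0 ≤ᵐ[spikeLaw n m] spikePostMean n m lam j :=
  condExp_nonneg (ae_of_all _ fun ω => by
    simp only [spikeSignal, Pi.zero_apply]; split_ifs <;> simp [hlam])

theorem sum_spikePostMean (n m : ℕ) [NeZero m] (lam : ℝ) :
    ∀ᵐ ω ∂spikeLaw n m, ∑ j, spikePostMean n m lam j ω = lam := by
  have h := condExp_finsetSum (μ := spikeLaw n m) (s := Finset.univ)
    (fun j _ => integrable_spikeSignal n m lam j)
    (MeasurableSpace.comap (spikeData n m lam) inferInstance)
  have hsum : ∑ j, (fun ω : SpikeOmega n m => spikeSignal m lam ω.2 j) = fun _ => lam := by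
    ext ω
    simp [spikeSignal]
  rw [hsum, condExp_const (measurable_spikeData n m lam).comap_le] at h
  filter_upwards [h] with ω hω
  rw [Finset.sum_apply] at hω
  exact hω.symm

/-- Any nonnegative allocation of total mass at most `lam` over the candidate locations, based on
the data, puts little mass on the true spike location. -/
theorem lintegral_allocation_spike_le {n m : ℕ} (hn : n ≠ 0) [NeZero m] {lam t s ε : ℝ}
    (hlam : 0 < lam) (hs : 0 < s) (hε : 0 < ε) (hts : (1 + ε) * lam ^ 2 / 2 ≤ t - s)
    {k : Fin m → (Fin n → Fin m → ℝ) × (Fin n → ℝ) → ℝ≥0∞} (hk : ∀ j, Measurable (k j))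
    (hksum : ∀ d, ∑ j, k j d ≤ ENNReal.ofReal lam) :
    ∫⁻ ω, k ω.2 (spikeData n m lam ω) ∂spikeLaw n m ≤
      ENNReal.ofReal (lam * (Real.exp t / m +
        (Var[fun x => x ^ 2; gaussianReal 0 1] / (n * ε ^ 2) + lam ^ 2 / s ^ 2))) := by
  have hkle : ∀ j d, k j d ≤ ENNReal.ofReal lam := fun j d =>
    (Finset.single_le_sum (f := fun j => k j d) (fun _ _ => zero_le)
      (Finset.mem_univ j)).trans (hksum d)
  have hF : Measurable fun ω : SpikeOmega n m => k ω.2 (spikeData n m lam ω) := by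
    have hk' : Measurable fun q : ((Fin n → Fin m → ℝ) × (Fin n → ℝ)) × Fin m => k q.2 q.1 :=
      measurable_from_prod_countable_left hk
    have hpair : Measurable fun ω : SpikeOmega n m => (spikeData n m lam ω, ω.2) :=
      (measurable_spikeData n m lam).prodMk measurable_snd
    exact Measurable.comp (g := fun q => k q.2 q.1)
      (f := fun ω : SpikeOmega n m => (spikeData n m lam ω, ω.2)) hk' hpair
  rw [lintegral_spikeLaw hF]
  simp only [spikeData_mk]
  set P := (Measure.pi fun _ : Fin n => Measure.pi fun _ : Fin m =>
    gaussianReal 0 (n : ℝ≥0)⁻¹).prod (Measure.pi fun _ : Fin n => gaussianReal 0 1)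
  set V := Var[fun x => x ^ 2; gaussianReal 0 1]
  have hV : 0 ≤ V := variance_nonneg _ _
  set q : ℝ := V / (n * ε ^ 2) + lam ^ 2 / s ^ 2
  have hq : ENNReal.ofReal (V / (n * ε ^ 2)) + ENNReal.ofReal (lam ^ 2 / s ^ 2) =
      ENNReal.ofReal q := (ENNReal.ofReal_add (by positivity) (by positivity)).symm
  have hm0 : (m : ℝ≥0∞) ≠ 0 := Nat.cast_ne_zero.2 (NeZero.ne m)
  have hm1 : (m : ℝ≥0∞)⁻¹ = ENNReal.ofReal (m : ℝ)⁻¹ := by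
    rw [ENNReal.ofReal_inv_of_pos (Nat.cast_pos.2 (NeZero.pos m)), ENNReal.ofReal_natCast]
  calc (m : ℝ≥0∞)⁻¹ * ∑ j, ∫⁻ p, k j (p.1, fun i => p.1 i j * lam + p.2 i) ∂P
      ≤ (m : ℝ≥0∞)⁻¹ * ∑ j, (ENNReal.ofReal (Real.exp t) * ∫⁻ p, k j p ∂P +
          ENNReal.ofReal lam * ENNReal.ofReal q) := by
        gcongr with j
        rw [← hq]
        exact lintegral_design_shift_le hn j lam (hk j) (hkle j) hs hε hlam hts
    _ = (m : ℝ≥0∞)⁻¹ * (ENNReal.ofReal (Real.exp t) * ∫⁻ p, ∑ j, k j p ∂P +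
          m * (ENNReal.ofReal lam * ENNReal.ofReal q)) := by
        rw [Finset.sum_add_distrib, ← Finset.mul_sum, lintegral_finsetSum _ fun j _ => hk j]
        simp
    _ ≤ (m : ℝ≥0∞)⁻¹ * (ENNReal.ofReal (Real.exp t) * ENNReal.ofReal lam +
          m * (ENNReal.ofReal lam * ENNReal.ofReal q)) := by
        gcongr
        refine (lintegral_mono hksum).trans ?_
        simp
    _ = ENNReal.ofReal (lam * (Real.exp t / m + q)) := by
        rw [mul_add, ← mul_assoc _ (m : ℝ≥0∞),
          ENNReal.inv_mul_cancel hm0 (ENNReal.natCast_ne_top m), one_mul, hm1,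
          ← ENNReal.ofReal_mul (by positivity), ← ENNReal.ofReal_mul (by positivity),
          ← ENNReal.ofReal_mul (by positivity), ← ENNReal.ofReal_add (by positivity) (by positivity)]
        congr 1
        ring

/-- The posterior mean puts little mass on the true spike location. -/
theorem lintegral_spikePostMean_spike_le {n m : ℕ} (hn : n ≠ 0) [NeZero m] {lam t s ε : ℝ}
    (hlam : 0 < lam) (hs : 0 < s) (hε : 0 < ε) (hts : (1 + ε) * lam ^ 2 / 2 ≤ t - s) :
    ∫⁻ ω, ENNReal.ofReal (spikePostMean n m lam ω.2 ω) ∂spikeLaw n m ≤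
      ENNReal.ofReal (lam * (Real.exp t / m +
        (Var[fun x => x ^ 2; gaussianReal 0 1] / (n * ε ^ 2) + lam ^ 2 / s ^ 2))) := by
  have hfac : ∀ j, ∃ h : (Fin n → Fin m → ℝ) × (Fin n → ℝ) → ℝ, StronglyMeasurable h ∧
      spikePostMean n m lam j = h ∘ spikeData n m lam := fun j =>
    StronglyMeasurable.exists_eq_measurable_comp stronglyMeasurable_condExp
  choose h hmeas heq using hfac
  have hmeas' : ∀ j, Measurable (h j) := fun j => (hmeas j).measurable
  let G : Set ((Fin n → Fin m → ℝ) × (Fin n → ℝ)) :=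
    {d | ∑ i, ENNReal.ofReal (h i d) ≤ ENNReal.ofReal lam}
  have hG : MeasurableSet G := measurableSet_le (by fun_prop) measurable_const
  let k : Fin m → (Fin n → Fin m → ℝ) × (Fin n → ℝ) → ℝ≥0∞ := fun j =>
    G.indicator fun d => ENNReal.ofReal (h j d)
  have hk : ∀ j, Measurable (k j) := fun j => (hmeas' j).ennreal_ofReal.indicator hG
  have hksum : ∀ d, ∑ j, k j d ≤ ENNReal.ofReal lam := fun d => by
    by_cases hd : d ∈ G
    · simp only [k, Set.indicator_of_mem hd]
      exact hd
    · simp [k, hd]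
  have hae : ∀ᵐ ω ∂spikeLaw n m, ENNReal.ofReal (spikePostMean n m lam ω.2 ω) =
      k ω.2 (spikeData n m lam ω) := by
    filter_upwards [sum_spikePostMean n m lam,
      ae_all_iff.2 fun j => spikePostMean_nonneg (n := n) hlam.le j] with ω hsum hnn
    have hω : spikeData n m lam ω ∈ G := by
      change ∑ i, ENNReal.ofReal ((h i ∘ spikeData n m lam) ω) ≤ _
      simp only [← heq]
      rw [← ENNReal.ofReal_sum_of_nonneg fun i _ => hnn i, hsum]
    simp only [k, Set.indicator_of_mem hω]
    rw [heq]
    rfl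
  rw [lintegral_congr_ae hae]
  exact lintegral_allocation_spike_le hn hlam hs hε hts hk hksum

theorem spikeBayesRisk_bounds {n m : ℕ} (hn : n ≠ 0) [NeZero m] {lam t s ε : ℝ}
    (hlam : 0 < lam) (hs : 0 < s) (hε : 0 < ε) (hts : (1 + ε) * lam ^ 2 / 2 ≤ t - s) :
    1 - 2 * (Real.exp t / m + (Var[fun x => x ^ 2; gaussianReal 0 1] / (n * ε ^ 2) +
      lam ^ 2 / s ^ 2)) ≤ spikeBayesRisk n m lam / lam ^ 2 ∧
      spikeBayesRisk n m lam / lam ^ 2 ≤ 2 := by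
  set V := Var[fun x => x ^ 2; gaussianReal 0 1]
  have hV : 0 ≤ V := variance_nonneg _ _
  set r : ℝ := Real.exp t / m + (V / (n * ε ^ 2) + lam ^ 2 / s ^ 2)
  have hr : 0 ≤ r := by positivity
  have hpm : ∀ j, Measurable (spikePostMean n m lam j) := fun j =>
    (stronglyMeasurable_condExp.mono (measurable_spikeData n m lam).comap_le).measurable
  have hsig := measurable_spikeSignal n m lam
  have hspike : Measurable fun ω : SpikeOmega n m => spikePostMean n m lam ω.2 ω := by
    have hk' : Measurable fun q : SpikeOmega n m × Fin m => spikePostMean n m lam q.2 q.1 :=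
      measurable_from_prod_countable_left hpm
    exact hk'.comp (measurable_id.prodMk measurable_snd)
  have hexpand : ∀ ω : SpikeOmega n m,
      ∑ j, (spikePostMean n m lam j ω - spikeSignal m lam ω.2 j) ^ 2 =
        ∑ j, spikePostMean n m lam j ω ^ 2 - 2 * lam * spikePostMean n m lam ω.2 ω + lam ^ 2 :=
    fun ω => by
    have h1 : ∑ j, 2 * spikePostMean n m lam j ω * spikeSignal m lam ω.2 j =
        2 * lam * spikePostMean n m lam ω.2 ω := by
      simp [spikeSignal]; ring
    have h2 : ∑ j, spikeSignal m lam ω.2 j ^ 2 = lam ^ 2 := by simp [spikeSignal]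
    simp only [sub_sq, Finset.sum_add_distrib, Finset.sum_sub_distrib, h1, h2]
  have hgood : ∀ᵐ ω ∂spikeLaw n m, (∀ j, 0 ≤ spikePostMean n m lam j ω) ∧
      (∀ j, spikePostMean n m lam j ω ≤ lam) ∧
      ∑ j, spikePostMean n m lam j ω ^ 2 ≤ lam ^ 2 := by
    filter_upwards [sum_spikePostMean n m lam,
      ae_all_iff.2 fun j => spikePostMean_nonneg (n := n) hlam.le j] with ω hsum hnn
    have hle : ∀ j, spikePostMean n m lam j ω ≤ lam := fun j =>
      (Finset.single_le_sum (fun i _ => hnn i) (Finset.mem_univ j)).trans_eq hsum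
    refine ⟨hnn, hle, ?_⟩
    calc ∑ j, spikePostMean n m lam j ω ^ 2 ≤ ∑ j, lam * spikePostMean n m lam j ω :=
          Finset.sum_le_sum fun j _ => by
            rw [sq]; exact mul_le_mul_of_nonneg_right (hle j) (hnn j)
      _ = lam ^ 2 := by rw [← Finset.mul_sum, hsum, sq]
  have hspike_int : Integrable (fun ω : SpikeOmega n m => spikePostMean n m lam ω.2 ω)
      (spikeLaw n m) :=
    Integrable.of_bound hspike.aestronglyMeasurable lam (by
      filter_upwards [hgood] with ω ⟨h0, h1, _⟩
      rw [Real.norm_of_nonneg (h0 _)]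
      exact h1 _)
  have hloss_le : ∀ᵐ ω ∂spikeLaw n m,
      ∑ j, (spikePostMean n m lam j ω - spikeSignal m lam ω.2 j) ^ 2 ≤ 2 * lam ^ 2 := by
    filter_upwards [hgood] with ω ⟨h0, _, h2⟩
    rw [hexpand]
    have := mul_nonneg hlam.le (h0 ω.2)
    linarith
  have hloss_int : Integrable (fun ω : SpikeOmega n m =>
      ∑ j, (spikePostMean n m lam j ω - spikeSignal m lam ω.2 j) ^ 2) (spikeLaw n m) :=
    Integrable.of_bound (Measurable.aestronglyMeasurable (by fun_prop)) (2 * lam ^ 2) (by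
      filter_upwards [hloss_le] with ω h
      rwa [Real.norm_of_nonneg (Finset.sum_nonneg fun j _ => sq_nonneg _)])
  have hspike_le : ∫ ω, spikePostMean n m lam ω.2 ω ∂spikeLaw n m ≤ lam * r := by
    rw [integral_eq_lintegral_of_nonneg_ae
      (by filter_upwards [hgood] with ω h using h.1 _) hspike.aestronglyMeasurable]
    exact ENNReal.toReal_le_of_le_ofReal (by positivity)
      (lintegral_spikePostMean_spike_le hn hlam hs hε hts)
  constructor
  · rw [le_div_iff₀ (by positivity)]
    calc (1 - 2 * r) * lam ^ 2 = lam ^ 2 - 2 * lam * (lam * r) := by ring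
      _ ≤ lam ^ 2 - 2 * lam * ∫ ω, spikePostMean n m lam ω.2 ω ∂spikeLaw n m := by gcongr
      _ = ∫ ω, (lam ^ 2 - 2 * lam * spikePostMean n m lam ω.2 ω) ∂spikeLaw n m := by
        rw [integral_sub (integrable_const _) (hspike_int.const_mul _), integral_const_mul]
        simp
      _ ≤ spikeBayesRisk n m lam := by
        refine integral_mono ((integrable_const _).sub (hspike_int.const_mul _)) hloss_int
          fun ω => ?_
        simp only [hexpand]
        have : 0 ≤ ∑ j, spikePostMean n m lam j ω ^ 2 := Finset.sum_nonneg fun j _ => sq_nonneg _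
        linarith
  · rw [div_le_iff₀ (by positivity)]
    refine (integral_mono_ae hloss_int (integrable_const (2 * lam ^ 2)) hloss_le).trans_eq ?_
    simp

/-- **Lemma 6.** For the single spike prior `π = π_S(λ; m)`, if `m → ∞`,
`(log m)/n → 0`, `λ > 0` and `λ² ≤ (2−δ) log m` for a fixed `δ ∈ (0,1)`, then
`E_π ‖β̂_π − β‖₂² ≥ λ² (1 + o(1))`. -/
theorem spike_prior_bayes_risk_lower
    (m : ℕ → ℕ) (lam : ℕ → ℝ) (δ : ℝ) (hδ : δ ∈ Set.Ioo (0 : ℝ) 1)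
    (hm : Tendsto (fun n => (m n : ℝ)) atTop atTop)
    (hlog : Tendsto (fun n => Real.log (m n) / n) atTop (nhds 0))
    (hlam : ∀ n, 0 < lam n)
    (hlam2 : ∀ n, lam n ^ 2 ≤ (2 - δ) * Real.log (m n)) :
    1 ≤ Filter.liminf (fun n => spikeBayesRisk n (m n) (lam n) / lam n ^ 2) atTop := by
  obtain ⟨hδ0, hδ1⟩ := hδ
  set V := Var[fun x => x ^ 2; gaussianReal 0 1]
  set L : ℕ → ℝ := fun n => Real.log (m n)
  have hL : Tendsto L atTop atTop := Real.tendsto_log_atTop.comp hm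
  let g : ℕ → ℝ := fun n => 1 - 2 * (Real.exp (-(δ / 4) * L n) +
    (V / (δ / 8) ^ 2 * (n : ℝ)⁻¹ + 2 / (δ / 8) ^ 2 * (L n)⁻¹))
  have hg : Tendsto g atTop (nhds 1) := by
    have h1 : Tendsto (fun n => Real.exp (-(δ / 4) * L n)) atTop (nhds 0) :=
      Real.tendsto_exp_atBot.comp (hL.const_mul_atTop_of_neg (by linarith))
    have h2 : Tendsto (fun n : ℕ => V / (δ / 8) ^ 2 * (n : ℝ)⁻¹) atTop (nhds 0) := by
      simpa using (tendsto_inv_atTop_nhds_zero_nat (𝕜 := ℝ)).const_mul (V / (δ / 8) ^ 2)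
    have h3 : Tendsto (fun n => 2 / (δ / 8) ^ 2 * (L n)⁻¹) atTop (nhds 0) := by
      simpa using (tendsto_inv_atTop_zero.comp hL).const_mul (2 / (δ / 8) ^ 2)
    simpa [g] using ((h1.add (h2.add h3)).const_mul 2).const_sub 1
  have hbounds : ∀ᶠ n in atTop, g n ≤ spikeBayesRisk n (m n) (lam n) / lam n ^ 2 ∧
      spikeBayesRisk n (m n) (lam n) / lam n ^ 2 ≤ 2 := by
    filter_upwards [hL.eventually_gt_atTop 0, hm.eventually_gt_atTop 0,
      eventually_ne_atTop 0] with n hLn hmn hn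
    have : NeZero (m n) := ⟨by rintro h; simp [h] at hmn⟩
    have hlamn : lam n ^ 2 ≤ (2 - δ) * L n := hlam2 n
    have hts : (1 + δ / 8) * lam n ^ 2 / 2 ≤ (1 - δ / 4) * L n - δ / 8 * L n := by
      have h1 : (1 + δ / 8) * lam n ^ 2 ≤ (1 + δ / 8) * ((2 - δ) * L n) := by gcongr
      have h2 : 0 ≤ δ ^ 2 * L n := by positivity
      nlinarith
    obtain ⟨hlow, hup⟩ := spikeBayesRisk_bounds hn (m := m n) (hlam n)
      (s := δ / 8 * L n) (by positivity) (ε := δ / 8) (by positivity) hts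
    refine ⟨le_trans ?_ hlow, hup⟩
    have hexp : Real.exp ((1 - δ / 4) * L n) / m n = Real.exp (-(δ / 4) * L n) := by
      rw [div_eq_iff hmn.ne', ← Real.exp_log hmn, ← Real.exp_add]
      congr 1
      change _ = _ + L n
      ring
    have hvar : V / (n * (δ / 8) ^ 2) = V / (δ / 8) ^ 2 * (n : ℝ)⁻¹ := by
      rw [mul_comm, div_mul_eq_div_div, div_eq_mul_inv _ (n : ℝ)]
    have hsq : lam n ^ 2 / (δ / 8 * L n) ^ 2 ≤ 2 / (δ / 8) ^ 2 * (L n)⁻¹ := by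
      have h1 : lam n ^ 2 ≤ 2 * L n := hlamn.trans (by gcongr; linarith)
      calc lam n ^ 2 / (δ / 8 * L n) ^ 2 ≤ 2 * L n / (δ / 8 * L n) ^ 2 := by gcongr
        _ = 2 / (δ / 8) ^ 2 * (L n)⁻¹ := by field_simp
    simp only [g]
    rw [hexp, hvar]
    linarith
  rw [← hg.liminf_eq]
  refine liminf_le_liminf (hbounds.mono fun n h => h.1) hg.isBoundedUnder_ge ?_
  exact (isBoundedUnder_of_eventually_le (hbounds.mono fun n h => h.2)).isCoboundedUnder_ge
end
end

section
/- Let √n·X₁, …, √n·X_m, z be i.i.d. N(0, I_n) random vectors, with m = m_n and λ = λ_n depending on n. For each i, write X_{i,1} for the first coordinate of X_i and X_{i,−1} ∈ ℝ^{n−1} for the remaining coordinates. Define 𝒜_{n,m} = [ Σ_{i=2}^m exp( ‖λX₁+z‖₂·λX_{i,1} − (λ²/2)X_{i,1}² − (λ²/2)‖X_{i,−1}‖₂² ) ] / [ (m−1)·(1+λ²/n)^{−n/2}·exp( (λ²/(2(n+λ²)))·‖z+λX₁‖₂² ) ]. Suppose m → ∞ and (log m)/n → 0. If λ > 0 and λ²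 ≤ (2−δ)·log m for a fixed constant δ ∈ (0,1), then 𝒜_{n,m} → 1 in probability. -/
open MeasureTheory ProbabilityTheory Filter
open scoped NNReal ENNReal

noncomputable section

/-- The joint law of `(X₁, …, X_m, z)` where the `X_j` are i.i.d. `N(0, (1/n) I_n)` and
`z ~ N(0, I_n)` is independent of them. -/
def XZlaw (n m : ℕ) : Measure ((Fin m → Fin n → ℝ) × (Fin n → ℝ)) :=
  (Measure.pi fun _ : Fin m => Measure.pi fun _ : Fin n => gaussianReal 0 (n : ℝ≥0)⁻¹).prod
    (Measure.pi fun _ : Fin n => gaussianReal 0 1)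

/-- The first coordinate `v₁` of a vector `v ∈ ℝ^n`. -/
def firstCoord {n : ℕ} (v : Fin n → ℝ) : ℝ := if h : 0 < n then v ⟨0, h⟩ else 0

/-- `‖v_{−1}‖₂²`, the squared norm of a vector with its first coordinate removed. -/
def restSq {n : ℕ} (v : Fin n → ℝ) : ℝ := (∑ i, v i ^ 2) - firstCoord v ^ 2

/-- The random variable
`𝒜_{n,m} = [Σ_{i=2}^m exp(‖λX₁+z‖₂ λ X_{i,1} − (λ²/2)X_{i,1}² − (λ²/2)‖X_{i,−1}‖₂²)] /
[(m−1)(1+λ²/n)^{−n/2} exp(λ²/(2(n+λ²)) ‖z+λX₁‖₂²)]`,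
written in terms of `X_i = ω.1 i` and `z = ω.2`; `X₁ = ω.1 i₀`. -/
def Anm (n m : ℕ) (hm : 0 < m) (lam : ℝ)
    (ω : (Fin m → Fin n → ℝ) × (Fin n → ℝ)) : ℝ :=
  (∑ i ∈ Finset.univ.filter (fun i : Fin m => i ≠ ⟨0, hm⟩),
      Real.exp (Real.sqrt (∑ i', (lam * ω.1 ⟨0, hm⟩ i' + ω.2 i') ^ 2) *
          lam * firstCoord (ω.1 i) -
        lam ^ 2 / 2 * firstCoord (ω.1 i) ^ 2 - lam ^ 2 / 2 * restSq (ω.1 i))) /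
    (((m : ℝ) - 1) * (1 + lam ^ 2 / n) ^ (-(n : ℝ) / 2) *
      Real.exp (lam ^ 2 / (2 * (n + lam ^ 2)) *
        ∑ i, (ω.2 i + lam * ω.1 ⟨0, hm⟩ i) ^ 2))

/-- Tilting a centred Gaussian density by `exp (a x - b x²)` gives a multiple of a Gaussian
density. -/
lemma gaussianPDFReal_mul_exp {v : ℝ≥0} (hv : v ≠ 0) (a : ℝ) (b : ℝ≥0) (x : ℝ) :
    gaussianPDFReal 0 v x * Real.exp (a * x - b * x ^ 2) =
      (Real.sqrt (1 + 2 * b * v))⁻¹ * Real.exp (a ^ 2 * v / (2 * (1 + 2 * b * v))) *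
        gaussianPDFReal (a * (v / (1 + 2 * b * v))) (v / (1 + 2 * b * v)) x := by
  have hv' : (0 : ℝ) < v := by exact_mod_cast pos_iff_ne_zero.2 hv
  have hb : (0 : ℝ) ≤ b := b.2
  have hw : (0 : ℝ) < 1 + 2 * b * v := by positivity
  simp only [gaussianPDFReal]
  push_cast
  have h1 : Real.sqrt (2 * Real.pi * (v / (1 + 2 * b * v))) =
      Real.sqrt (2 * Real.pi * v) / Real.sqrt (1 + 2 * b * v) := by
    rw [← Real.sqrt_div (by positivity), mul_div_assoc]
  rw [h1, mul_assoc, ← Real.exp_add]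
  have h2 : -(x - 0) ^ 2 / (2 * v) + (a * x - b * x ^ 2) =
      a ^ 2 * v / (2 * (1 + 2 * b * v)) +
        -(x - a * (v / (1 + 2 * b * v))) ^ 2 / (2 * (v / (1 + 2 * b * v))) := by
    field_simp
    ring
  rw [h2, Real.exp_add]
  have := Real.sqrt_pos.2 hw
  have : 0 < Real.sqrt (2 * Real.pi * v) := Real.sqrt_pos.2 (by positivity)
  field_simp

lemma integral_exp_quadratic_gaussianReal {v : ℝ≥0} (hv : v ≠ 0) (a : ℝ) (b : ℝ≥0) :
    ∫ x, Real.exp (a * x - b * x ^ 2) ∂(gaussianReal 0 v) =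
      (Real.sqrt (1 + 2 * b * v))⁻¹ * Real.exp (a ^ 2 * v / (2 * (1 + 2 * b * v))) := by
  have hw : v / (1 + 2 * b * v) ≠ 0 := by positivity
  rw [integral_gaussianReal_eq_integral_smul hv]
  simp only [smul_eq_mul, gaussianPDFReal_mul_exp hv]
  rw [integral_const_mul, integral_gaussianPDFReal_eq_one _ hw, mul_one]

lemma integrable_exp_quadratic_gaussianReal {v : ℝ≥0} (hv : v ≠ 0) (a : ℝ) (b : ℝ≥0) :
    Integrable (fun x => Real.exp (a * x - b * x ^ 2)) (gaussianReal 0 v) := by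
  refine Integrable.of_integral_ne_zero ?_
  rw [integral_exp_quadratic_gaussianReal hv]
  have hv' : (0 : ℝ) ≤ v := v.2
  have hb : (0 : ℝ) ≤ b := b.2
  positivity

lemma firstCoord_sq_add_restSq {n : ℕ} (v : Fin n → ℝ) :
    firstCoord v ^ 2 + restSq v = ∑ i, v i ^ 2 := by
  simp [restSq]

lemma exp_tilt_eq_prod {n : ℕ} (a : ℝ) (b : ℝ≥0) (x : Fin (n + 1) → ℝ) :
    Real.exp (a * firstCoord x - b * ∑ i, x i ^ 2) =
      ∏ i, Real.exp ((if i = 0 then a else 0) * x i - b * x i ^ 2) := by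
  rw [← Real.exp_sum, Finset.sum_sub_distrib, Finset.mul_sum]
  simp [firstCoord]

lemma integrable_exp_tilt {n : ℕ} {v : ℝ≥0} (hv : v ≠ 0) (a : ℝ) (b : ℝ≥0) :
    Integrable (fun x : Fin (n + 1) → ℝ => Real.exp (a * firstCoord x - b * ∑ i, x i ^ 2))
      (Measure.pi fun _ => gaussianReal 0 v) := by
  simp only [exp_tilt_eq_prod]
  exact Integrable.fintype_prod
    (f := fun i x => Real.exp ((if i = 0 then a else 0) * x - b * x ^ 2))
    fun i => integrable_exp_quadratic_gaussianReal hv _ b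

lemma integral_exp_tilt {n : ℕ} {v : ℝ≥0} (hv : v ≠ 0) (a : ℝ) (b : ℝ≥0) :
    ∫ x : Fin (n + 1) → ℝ, Real.exp (a * firstCoord x - b * ∑ i, x i ^ 2)
      ∂(Measure.pi fun _ => gaussianReal 0 v) =
      (1 + 2 * b * v : ℝ) ^ (-((n + 1 : ℕ) : ℝ) / 2) *
        Real.exp (a ^ 2 * v / (2 * (1 + 2 * b * v))) := by
  have hw : (0 : ℝ) ≤ 1 + 2 * b * v := by
    have hv' : (0 : ℝ) ≤ v := v.2
    have hb : (0 : ℝ) ≤ b := b.2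
    positivity
  simp only [exp_tilt_eq_prod]
  rw [integral_fintype_prod_eq_prod
    (f := fun i x => Real.exp ((if i = 0 then a else 0) * x - b * x ^ 2))]
  simp only [integral_exp_quadratic_gaussianReal hv, Finset.prod_mul_distrib]
  rw [Finset.prod_const, ← Real.exp_sum, Fin.sum_univ_succ]
  congr 1
  · rw [Finset.card_univ, Fintype.card_fin, Real.sqrt_eq_rpow, ← Real.rpow_neg hw,
      ← Real.rpow_natCast, ← Real.rpow_mul hw]
    congr 1
    ring
  · simp [Fin.succ_ne_zero]

lemma sub_min_le_rpow {t x p : ℝ} (ht : 0 < t) (hx : 0 ≤ x) (hp : 1 ≤ p) :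
    x - min x t ≤ t ^ (1 - p) * x ^ p := by
  rcases le_or_gt x t with h | h
  · rw [min_eq_left h, sub_self]
    positivity
  · have hx' : 0 < x := ht.trans h
    have h1 : 1 ≤ (x / t) ^ (p - 1) :=
      Real.one_le_rpow ((one_le_div ht).2 h.le) (by linarith)
    have h2 : t ^ (1 - p) * x ^ p = x * (x / t) ^ (p - 1) := by
      rw [Real.div_rpow hx'.le ht.le, Real.rpow_sub_one hx'.ne', show 1 - p = -(p - 1) by ring,
        Real.rpow_neg ht.le]
      field_simp
    rw [h2]
    have : 0 ≤ min x t := le_min hx ht.le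
    nlinarith

lemma min_sq_le_rpow {t x p : ℝ} (ht : 0 < t) (hx : 0 ≤ x) (hp : 1 ≤ p) (hp2 : p ≤ 2) :
    min x t ^ 2 ≤ t * (t ^ (1 - p) * x ^ p) := by
  have h0 : 0 ≤ min x t := le_min hx ht.le
  have h1 : min x t ^ 2 = min x t ^ (2 - p) * min x t ^ p := by
    rw [← Real.rpow_add' h0 (by norm_num)]
    norm_num
  have h2 : t * (t ^ (1 - p) * x ^ p) = t ^ (2 - p) * x ^ p := by
    rw [← mul_assoc, show (2 - p) = 1 + (1 - p) by ring, Real.rpow_add ht, Real.rpow_one]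
  rw [h1, h2]
  have h3 : min x t ≤ t := min_le_right _ _
  have h4 : min x t ≤ x := min_le_left _ _
  exact mul_le_mul (Real.rpow_le_rpow h0 h3 (by linarith)) (Real.rpow_le_rpow h0 h4 (by linarith))
    (by positivity) (by positivity)

section

variable {α : Type*} [MeasurableSpace α]

lemma integral_abs_le_sqrt_integral_sq {P : Measure α} [IsProbabilityMeasure P] {X : α → ℝ}
    (hX : MemLp X 2 P) : ∫ a, |X a| ∂P ≤ Real.sqrt (∫ a, X a ^ 2 ∂P) := by
  apply Real.le_sqrt_of_sq_le
  have h := variance_nonneg |X| P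
  rw [variance_eq_sub hX.abs] at h
  simpa [sq_abs] using h

/-- A weak law of large numbers in `L¹` for i.i.d. nonnegative variables of mean one with a finite
moment of order `p ∈ [1, 2]`, in quantitative form. -/
lemma integral_abs_average_sub_one_le {P : Measure α} [IsProbabilityMeasure P] {f : α → ℝ}
    (hf : Measurable f) (hf0 : ∀ a, 0 ≤ f a) (hfi : Integrable f P) (hf1 : ∫ a, f a ∂P = 1)
    {p : ℝ} (hp : 1 ≤ p) (hp2 : p ≤ 2) (hfp : Integrable (fun a => f a ^ p) P)
    {k : ℕ} (hk : 0 < k) :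
    ∫ x : Fin k → α, |(∑ i, f (x i)) / k - 1| ∂(Measure.pi fun _ => P) ≤
      Real.sqrt ((k : ℝ) ^ (1 - p) * ∫ a, f a ^ p ∂P) +
        2 * ((k : ℝ) ^ (1 - p) * ∫ a, f a ^ p ∂P) := by
  set η := (k : ℝ) ^ (1 - p) * ∫ a, f a ^ p ∂P with hη
  have hk' : (0 : ℝ) < k := by exact_mod_cast hk
  set g : α → ℝ := fun a => min (f a) k with hg
  have hgm : Measurable g := hf.min measurable_const
  have hg0 : ∀ a, 0 ≤ g a := fun a => le_min (hf0 a) hk'.le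
  have hgk : ∀ a, g a ≤ k := fun a => min_le_right _ _
  have hgf : ∀ a, g a ≤ f a := fun a => min_le_left _ _
  have hg2 : MemLp g 2 P := MemLp.of_bound hgm.aestronglyMeasurable k
    (Eventually.of_forall fun a => by rw [Real.norm_of_nonneg (hg0 a)]; exact hgk a)
  have hgi : Integrable g P := hg2.integrable (by norm_num)
  have hsub : ∫ a, (f a - g a) ∂P ≤ η := by
    rw [hη, ← integral_const_mul]
    exact integral_mono (hfi.sub hgi) (hfp.const_mul _)
      fun a => sub_min_le_rpow hk' (hf0 a) hp
  have hsq : ∫ a, g a ^ 2 ∂P ≤ k * η := by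
    rw [hη, ← integral_const_mul, ← integral_const_mul]
    exact integral_mono hg2.integrable_sq ((hfp.const_mul _).const_mul _)
      fun a => min_sq_le_rpow hk' (hf0 a) hp hp2
  set c := ∫ a, g a ∂P with hc
  have hc1 : 1 - c ≤ η := by
    rw [integral_sub hfi hgi, hf1] at hsub
    exact hsub
  have hc2 : c ≤ 1 := by
    rw [← hf1]
    exact integral_mono hgi hfi hgf
  let Q : Measure (Fin k → α) := Measure.pi fun _ => P
  have hfQ : ∀ i : Fin k, Integrable (fun x : Fin k → α => f (x i)) Q := fun i =>
    integrable_comp_eval (μ := fun _ : Fin k => P) (i := i) hfi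
  have hgQ : ∀ i : Fin k, MemLp (fun x : Fin k → α => g (x i)) 2 Q := fun i =>
    hg2.comp_measurePreserving (measurePreserving_eval (fun _ : Fin k => P) i)
  have hgQi : ∀ i : Fin k, Integrable (fun x : Fin k → α => g (x i)) Q := fun i =>
    (hgQ i).integrable (by norm_num)
  have hfe : ∀ i : Fin k, ∫ x : Fin k → α, f (x i) ∂Q = 1 := fun i => by
    rw [integral_comp_eval (μ := fun _ : Fin k => P) hfi.aestronglyMeasurable, hf1]
  have hge : ∀ i : Fin k, ∫ x : Fin k → α, g (x i) ∂Q = c := fun i => by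
    rw [integral_comp_eval (μ := fun _ : Fin k => P) hgi.aestronglyMeasurable]
  have hSg : MemLp (fun x : Fin k → α => ∑ i, g (x i)) 2 Q := memLp_finsetSum _ fun i _ => hgQ i
  have hSf : Integrable (fun x : Fin k → α => ∑ i, f (x i)) Q :=
    integrable_finsetSum _ fun i _ => hfQ i
  have hSgi := hSg.integrable (by norm_num)
  have hSge : ∫ x, (∑ i, g (x i)) ∂Q = k * c := by
    rw [integral_finsetSum _ fun i _ => hgQi i]
    simp [hge]
  have hSfe : ∫ x, (∑ i, f (x i)) ∂Q = k := by
    rw [integral_finsetSum _ fun i _ => hfQ i]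
    simp [hfe]
  have hvar : Var[fun x : Fin k → α => ∑ i, g (x i); Q] ≤ k * (k * η) := by
    have h := variance_sum_pi (μ := fun _ : Fin k => P) (X := fun _ => g) fun _ => hg2
    have h' : (∑ i : Fin k, fun x : Fin k → α => g (x i)) = fun x => ∑ i, g (x i) := by
      ext x
      simp
    rw [h'] at h
    rw [h, Finset.sum_const, Finset.card_univ, Fintype.card_fin, nsmul_eq_mul]
    have : Var[g; P] ≤ k * η := (variance_le_expectation_sq hgm.aestronglyMeasurable).trans hsq
    gcongr
  have hcen : MemLp (fun x : Fin k → α => (∑ i, g (x i)) / k - c) 2 Q := by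
    simp only [div_eq_mul_inv]
    exact (hSg.mul_const _).sub (memLp_const c)
  have hcen2 : ∫ x, ((∑ i, g (x i)) / k - c) ^ 2 ∂Q ≤ η := by
    rw [variance_eq_integral hSg.aemeasurable, hSge] at hvar
    have h' : ∀ x : Fin k → α, ((∑ i, g (x i)) / k - c) ^ 2 =
        ((k : ℝ) ^ 2)⁻¹ * (∑ i, g (x i) - k * c) ^ 2 := fun x => by
      field_simp
    simp only [h']
    rw [integral_const_mul, inv_mul_le_iff₀ (by positivity)]
    linarith
  have h1 : ∫ x, |(∑ i, g (x i)) / k - c| ∂Q ≤ Real.sqrt η :=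
    (integral_abs_le_sqrt_integral_sq hcen).trans (Real.sqrt_le_sqrt hcen2)
  have h2 : ∀ x : Fin k → α, |(∑ i, f (x i)) / k - 1| ≤ |(∑ i, g (x i)) / k - c| +
      ((∑ i, f (x i)) / k - (∑ i, g (x i)) / k) + (1 - c) := fun x => by
    have hle : (∑ i, g (x i)) / k ≤ (∑ i, f (x i)) / (k : ℝ) := by
      gcongr
      exact hgf _
    have := abs_sub_abs_le_abs_sub ((∑ i, g (x i)) / k) c
    rw [abs_le]
    constructor <;>
      linarith [neg_abs_le ((∑ i, g (x i)) / k - c), le_abs_self ((∑ i, g (x i)) / k - c)]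
  have hmono := integral_mono (μ := Q) ((hSf.div_const k).sub (integrable_const 1)).abs
    (((hcen.integrable (by norm_num)).abs.add ((hSf.div_const k).sub (hSgi.div_const k))).add
      (integrable_const (1 - c))) h2
  refine hmono.trans ?_
  rw [integral_add' ((hcen.integrable (by norm_num)).abs.add
      ((hSf.div_const k).sub (hSgi.div_const k))) (integrable_const (1 - c)),
    integral_add' (hcen.integrable (by norm_num)).abs ((hSf.div_const k).sub (hSgi.div_const k)),
    integral_sub' (hSf.div_const k) (hSgi.div_const k), integral_div, integral_div, hSge, hSfe]
  simp only [integral_const, probReal_univ, smul_eq_mul, one_mul]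
  have : (k : ℝ) / k - k * c / k = 1 - c := by
    field_simp
  linarith

/-- The tail form of `integral_abs_average_sub_one_le`. -/
lemma measure_average_sub_one_gt_le {P : Measure α} [IsProbabilityMeasure P] {f : α → ℝ}
    (hf : Measurable f) (hf0 : ∀ a, 0 ≤ f a) (hfi : Integrable f P) (hf1 : ∫ a, f a ∂P = 1)
    {p : ℝ} (hp : 1 ≤ p) (hp2 : p ≤ 2) (hfp : Integrable (fun a => f a ^ p) P)
    {k : ℕ} (hk : 0 < k) {K : ℝ} (hK : ∫ a, f a ^ p ∂P ≤ K) {ε : ℝ} (hε : 0 < ε) :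
    (Measure.pi fun _ : Fin k => P) {x | ε < |(∑ i, f (x i)) / k - 1|} ≤
      ENNReal.ofReal ((Real.sqrt ((k : ℝ) ^ (1 - p) * K) + 2 * ((k : ℝ) ^ (1 - p) * K)) / ε) := by
  have hfQ : ∀ i : Fin k, Integrable (fun x : Fin k → α => f (x i))
      (Measure.pi fun _ : Fin k => P) := fun i =>
    integrable_comp_eval (μ := fun _ : Fin k => P) (i := i) hfi
  have hint : Integrable (fun x : Fin k → α => |(∑ i, f (x i)) / k - 1|)
      (Measure.pi fun _ : Fin k => P) :=
    (((integrable_finsetSum _ fun i _ => hfQ i).div_const _).sub (integrable_const 1)).abs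
  have h := mul_meas_ge_le_integral_of_nonneg
    (Eventually.of_forall fun x => abs_nonneg _) hint ε
  have h2 := integral_abs_average_sub_one_le hf hf0 hfi hf1 hp hp2 hfp hk
  have h3 : Real.sqrt ((k : ℝ) ^ (1 - p) * ∫ a, f a ^ p ∂P) +
      2 * ((k : ℝ) ^ (1 - p) * ∫ a, f a ^ p ∂P) ≤
      Real.sqrt ((k : ℝ) ^ (1 - p) * K) + 2 * ((k : ℝ) ^ (1 - p) * K) := by
    gcongr
  refine (measure_mono (t := {x : Fin k → α | ε ≤ |(∑ i, f (x i)) / k - 1|})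
    fun x hx => Set.mem_ofPred.2 (le_of_lt (Set.mem_ofPred.1 hx))).trans ?_
  rw [← ofReal_measureReal]
  apply ENNReal.ofReal_le_ofReal
  rw [le_div_iff₀ hε]
  linarith

variable {β γ : Type*} [MeasurableSpace β] [MeasurableSpace γ]

/-- If, for all `(a, c)` in a set `G`, the sections of `T` have measure at most `B`, then the
measure of `T` is at most `B` plus the measure of the complement of `G`. -/
lemma measure_prod_prod_le_of_section_le (P : Measure α) (Q : Measure β) (R : Measure γ)
    [IsProbabilityMeasure P] [IsProbabilityMeasure Q] [IsProbabilityMeasure R]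
    {T : Set ((α × β) × γ)} (hT : MeasurableSet T) {G : Set (α × γ)} (hG : MeasurableSet G)
    {B : ℝ≥0∞} (h : ∀ q ∈ G, Q {b | ((q.1, b), q.2) ∈ T} ≤ B) :
    ((P.prod Q).prod R) T ≤ (P.prod R) Gᶜ + B := by
  have hmp : MeasurePreserving (fun q : (α × γ) × β => ((q.1.1, q.2), q.1.2))
      ((P.prod R).prod Q) ((P.prod Q).prod R) :=
    ((measurePreserving_prodAssoc P Q R).symm).comp
      (((MeasurePreserving.id P).prod Measure.measurePreserving_swap).comp
        (measurePreserving_prodAssoc P R Q))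
  rw [← hmp.measure_preimage hT.nullMeasurableSet, Measure.prod_apply (hmp.measurable hT)]
  calc ∫⁻ q, Q (Prod.mk q ⁻¹' ((fun q : (α × γ) × β => ((q.1.1, q.2), q.1.2)) ⁻¹' T)) ∂(P.prod R)
      ≤ ∫⁻ q, (Gᶜ.indicator 1 q + B) ∂(P.prod R) := by
        refine lintegral_mono fun q => ?_
        by_cases hq : q ∈ G
        · exact (h q hq).trans le_add_self
        · refine prob_le_one.trans ?_
          simp [hq]
    _ = (P.prod R) Gᶜ + B := by
        rw [lintegral_add_right _ measurable_const, lintegral_indicator_one hG.compl]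
        simp

end

/-- The summand of the normalised average `Anm`, as a function of `r = ‖λ X₁ + z‖₂` and `X_i`. -/
def normalizedTilt (n : ℕ) (lam r : ℝ) (x : Fin n → ℝ) : ℝ :=
  Real.exp (r * lam * firstCoord x - lam ^ 2 / 2 * firstCoord x ^ 2 - lam ^ 2 / 2 * restSq x) /
    ((1 + lam ^ 2 / n) ^ (-(n : ℝ) / 2) * Real.exp (lam ^ 2 / (2 * (n + lam ^ 2)) * r ^ 2))

lemma measurable_firstCoord {n : ℕ} : Measurable (firstCoord : (Fin n → ℝ) → ℝ) := by
  unfold firstCoord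
  split_ifs <;> fun_prop

lemma measurable_restSq {n : ℕ} : Measurable (restSq : (Fin n → ℝ) → ℝ) := by
  have := measurable_firstCoord (n := n)
  unfold restSq
  fun_prop

lemma normalizedTilt_nonneg (n : ℕ) (lam r : ℝ) (x : Fin n → ℝ) :
    0 ≤ normalizedTilt n lam r x := by
  unfold normalizedTilt
  positivity

lemma measurable_normalizedTilt (n : ℕ) (lam r : ℝ) : Measurable (normalizedTilt n lam r) := by
  have := measurable_firstCoord (n := n)
  have := measurable_restSq (n := n)
  unfold normalizedTilt
  fun_prop

lemma normalizedTilt_rpow {n : ℕ} (lam r : ℝ) {p : ℝ} (hp : 0 ≤ p) (x : Fin n → ℝ) :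
    normalizedTilt n lam r x ^ p =
      Real.exp (p * r * lam * firstCoord x -
        (p * lam ^ 2 / 2).toNNReal * ∑ i, x i ^ 2) /
      ((1 + lam ^ 2 / n) ^ (-(n : ℝ) / 2) *
        Real.exp (lam ^ 2 / (2 * (n + lam ^ 2)) * r ^ 2)) ^ p := by
  rw [normalizedTilt, Real.div_rpow (by positivity) (by positivity), ← Real.exp_mul,
    ← firstCoord_sq_add_restSq]
  congr 2
  rw [Real.coe_toNNReal _ (by positivity)]
  ring

lemma integrable_normalizedTilt_rpow {n : ℕ} (hn : 0 < n) (lam r : ℝ) {p : ℝ} (hp : 0 ≤ p) :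
    Integrable (fun x => normalizedTilt n lam r x ^ p)
      (Measure.pi fun _ => gaussianReal 0 (n : ℝ≥0)⁻¹) := by
  obtain ⟨n, rfl⟩ := Nat.exists_eq_add_one.2 hn
  simp only [normalizedTilt_rpow lam r hp]
  exact (integrable_exp_tilt (inv_ne_zero (Nat.cast_ne_zero.2 hn.ne')) _ _).div_const _

lemma integral_normalizedTilt_rpow {n : ℕ} (hn : 0 < n) (lam r : ℝ) {p : ℝ} (hp : 0 ≤ p) :
    ∫ x, normalizedTilt n lam r x ^ p ∂(Measure.pi fun _ => gaussianReal 0 (n : ℝ≥0)⁻¹) =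
      (1 + p * lam ^ 2 / n) ^ (-(n : ℝ) / 2) *
        Real.exp (p ^ 2 * r ^ 2 * lam ^ 2 / (2 * (n + p * lam ^ 2))) /
      ((1 + lam ^ 2 / n) ^ (-(n : ℝ) / 2) *
        Real.exp (lam ^ 2 / (2 * (n + lam ^ 2)) * r ^ 2)) ^ p := by
  obtain ⟨n, rfl⟩ := Nat.exists_eq_add_one.2 hn
  simp only [normalizedTilt_rpow lam r hp]
  rw [integral_div, integral_exp_tilt (inv_ne_zero (Nat.cast_ne_zero.2 hn.ne')),
    Real.coe_toNNReal _ (by positivity)]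
  congr 3
  · push_cast
    field_simp
  · push_cast
    have : (0 : ℝ) < n + 1 + p * lam ^ 2 := by positivity
    field_simp

lemma integral_normalizedTilt {n : ℕ} (hn : 0 < n) (lam r : ℝ) :
    ∫ x, normalizedTilt n lam r x ∂(Measure.pi fun _ => gaussianReal 0 (n : ℝ≥0)⁻¹) = 1 := by
  have h := integral_normalizedTilt_rpow hn lam r zero_le_one
  simp only [Real.rpow_one] at h
  rw [h, div_eq_one_iff_eq (by positivity)]
  congr 2
  · ring
  · ring

lemma sub_sq_div_two_le_log_one_add {x : ℝ} (hx : 0 ≤ x) : x - x ^ 2 / 2 ≤ Real.log (1 + x) := by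
  refine le_trans ?_ (Real.le_log_one_add_of_nonneg hx)
  rw [le_div_iff₀ (by positivity)]
  nlinarith [pow_nonneg hx 3]

lemma integral_normalizedTilt_rpow_le {n : ℕ} (hn : 0 < n) (lam : ℝ) {r p κ : ℝ} (hp : 1 ≤ p)
    (hr : r ^ 2 ≤ (1 + κ) * n) :
    ∫ x, normalizedTilt n lam r x ^ p ∂(Measure.pi fun _ => gaussianReal 0 (n : ℝ≥0)⁻¹) ≤
      Real.exp (lam ^ 2 / 2 * (p * (p - 1) * (1 + κ) + p ^ 2 * (lam ^ 2 / n) / 2)) := by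
  have hn' : (0 : ℝ) < n := by exact_mod_cast hn
  have hp0 : 0 < p := by linarith
  rw [integral_normalizedTilt_rpow hn lam r hp0.le, Real.rpow_def_of_pos (by positivity),
    Real.rpow_def_of_pos (x := 1 + lam ^ 2 / n) (by positivity), ← Real.exp_add, ← Real.exp_add,
    ← Real.exp_mul, ← Real.exp_sub, Real.exp_le_exp]
  have h1 : Real.log (1 + lam ^ 2 / n) ≤ lam ^ 2 / n := by
    have := Real.log_le_sub_one_of_pos (x := 1 + lam ^ 2 / n) (by positivity)
    linarith
  have h2 := sub_sq_div_two_le_log_one_add (x := p * lam ^ 2 / n) (by positivity)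
  have h3 : (p * Real.log (1 + lam ^ 2 / n) - Real.log (1 + p * lam ^ 2 / n)) * (n / 2) ≤
      lam ^ 2 / 2 * (p ^ 2 * (lam ^ 2 / n) / 2) := by
    calc _ ≤ (p * (lam ^ 2 / n) - (p * lam ^ 2 / n - (p * lam ^ 2 / n) ^ 2 / 2)) * (n / 2) := by
          gcongr
      _ = _ := by
          field_simp
          ring
  have h4 : p ^ 2 * r ^ 2 * lam ^ 2 / (2 * (n + p * lam ^ 2)) -
      lam ^ 2 / (2 * (n + lam ^ 2)) * r ^ 2 * p ≤ lam ^ 2 / 2 * (p * (p - 1) * (1 + κ)) := by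
    have e : p ^ 2 * r ^ 2 * lam ^ 2 / (2 * (n + p * lam ^ 2)) -
        lam ^ 2 / (2 * (n + lam ^ 2)) * r ^ 2 * p =
        lam ^ 2 / 2 * (p * (p - 1) * (r ^ 2 * (n / ((n + p * lam ^ 2) * (n + lam ^ 2))))) := by
      field_simp
      ring
    rw [e]
    have hp1 : 0 ≤ p - 1 := by linarith
    gcongr
    have h5 : (n : ℝ) / ((n + p * lam ^ 2) * (n + lam ^ 2)) ≤ 1 / n := by
      rw [div_le_div_iff₀ (by positivity) hn', one_mul]
      gcongr <;> simp only [le_add_iff_nonneg_right] <;> positivity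
    calc r ^ 2 * (n / ((n + p * lam ^ 2) * (n + lam ^ 2))) ≤ r ^ 2 * (1 / n) := by gcongr
      _ ≤ (1 + κ) * n * (1 / n) := by gcongr
      _ = 1 + κ := by field_simp
  linarith

/-- The squared norm of `λ X + z` is at most `((1 + c)² + c) n` with high probability. -/
lemma measure_norm_sq_gt_le {n : ℕ} (hn : 0 < n) (lam : ℝ) {c : ℝ} (hc : 0 < c) :
    ((Measure.pi fun _ : Fin n => gaussianReal 0 (n : ℝ≥0)⁻¹).prod
      (Measure.pi fun _ : Fin n => gaussianReal 0 1))
      {q | (1 + c) ^ 2 * n + c * n < ∑ i, (lam * q.1 i + q.2 i) ^ 2} ≤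
    ENNReal.ofReal ((1 + 1 / c) / c * (lam ^ 2 / n)) +
      ENNReal.ofReal ((Real.sqrt ((n : ℝ) ^ (1 - (2 : ℝ)) *
        ∫ x, (x ^ 2) ^ (2 : ℝ) ∂(gaussianReal 0 1)) +
        2 * ((n : ℝ) ^ (1 - (2 : ℝ)) * ∫ x, (x ^ 2) ^ (2 : ℝ) ∂(gaussianReal 0 1))) / c) := by
  have hn' : (0 : ℝ) < n := by exact_mod_cast hn
  set P := Measure.pi fun _ : Fin n => gaussianReal 0 (n : ℝ≥0)⁻¹ with hP
  set R := Measure.pi fun _ : Fin n => gaussianReal 0 1 with hR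
  have hsecond : ∀ v : ℝ≥0, ∫ x, x ^ 2 ∂(gaussianReal 0 v) = v := fun v => by
    have h := variance_fun_id_gaussianReal (μ := 0) (v := v)
    rw [variance_eq_integral (by fun_prop)] at h
    simpa using h
  have hint : ∀ v : ℝ≥0, Integrable (fun x : ℝ => x ^ 2) (gaussianReal 0 v) := fun v =>
    (memLp_id_gaussianReal 2).integrable_sq
  have hint4 : Integrable (fun x : ℝ => (x ^ 2) ^ (2 : ℝ)) (gaussianReal 0 1) := by
    have h := (memLp_id_gaussianReal (μ := 0) (v := 1) 4).integrable_norm_rpow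
      (by norm_num) (by norm_num)
    refine h.congr (Eventually.of_forall fun x => ?_)
    have : (x ^ 2) ^ (2 : ℝ) = x ^ 4 := by
      rw [Real.rpow_two]
      ring
    simp only [this, id_eq, Real.norm_eq_abs]
    norm_num [Even.pow_abs (show Even 4 by decide)]
  have hz : R {z : Fin n → ℝ | c < |(∑ i, z i ^ 2) / n - 1|} ≤ _ :=
    measure_average_sub_one_gt_le (P := gaussianReal 0 1) (f := fun x => x ^ 2) (by fun_prop)
      (fun _ => sq_nonneg _) (hint 1) (by simpa using hsecond 1) (p := 2) (by norm_num) le_rfl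
      hint4 hn le_rfl hc
  have hxi : ∀ i : Fin n, Integrable (fun x : Fin n → ℝ => x i ^ 2) P := fun i =>
    integrable_comp_eval (μ := fun _ : Fin n => gaussianReal 0 (n : ℝ≥0)⁻¹) (i := i)
      (f := fun x => x ^ 2) (hint _)
  have hxint : ∫ x, (∑ i, x i ^ 2) ∂P = 1 := by
    rw [integral_finsetSum _ fun i _ => hxi i]
    have : ∀ i : Fin n, ∫ x : Fin n → ℝ, x i ^ 2 ∂P = (n : ℝ)⁻¹ := fun i => by
      rw [integral_comp_eval (μ := fun _ : Fin n => gaussianReal 0 (n : ℝ≥0)⁻¹) (i := i)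
        (f := fun x => x ^ 2) (hint _).aestronglyMeasurable, hsecond]
      simp
    simp [this, hn'.ne']
  have hx : P {x | c * n ≤ (1 + 1 / c) * lam ^ 2 * ∑ i, x i ^ 2} ≤
      ENNReal.ofReal ((1 + 1 / c) / c * (lam ^ 2 / n)) := by
    have h := mul_meas_ge_le_integral_of_nonneg (μ := P)
      (f := fun x => (1 + 1 / c) * lam ^ 2 * ∑ i, x i ^ 2)
      (Eventually.of_forall fun x => by
        have : 0 ≤ ∑ i, x i ^ 2 := Finset.sum_nonneg fun i _ => sq_nonneg _
        simp only [Pi.zero_apply]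
        positivity)
      ((integrable_finsetSum _ fun i _ => hxi i).const_mul _) (c * n)
    rw [integral_const_mul, hxint, mul_one] at h
    rw [← ofReal_measureReal]
    apply ENNReal.ofReal_le_ofReal
    rw [← le_div_iff₀' (by positivity)] at h
    refine h.trans (le_of_eq ?_)
    field_simp
  refine le_trans (measure_mono (t := Prod.fst ⁻¹'
      {x : Fin n → ℝ | c * n ≤ (1 + 1 / c) * lam ^ 2 * ∑ i, x i ^ 2} ∪
      Prod.snd ⁻¹' {z : Fin n → ℝ | c < |(∑ i, z i ^ 2) / n - 1|}) ?_)
    ((measure_union_le _ _).trans ?_)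
  · rintro ⟨x, z⟩ hq
    simp only [Set.mem_union, Set.mem_preimage, Set.mem_ofPred] at hq ⊢
    by_contra! hcon
    have hz' : ∑ i, z i ^ 2 ≤ (1 + c) * n := by
      have := (le_abs_self _).trans hcon.2
      rw [sub_le_iff_le_add, div_le_iff₀ hn'] at this
      linarith
    have hle : ∑ i, (lam * x i + z i) ^ 2 ≤
        (1 + 1 / c) * lam ^ 2 * ∑ i, x i ^ 2 + (1 + c) * ∑ i, z i ^ 2 := by
      rw [Finset.mul_sum, Finset.mul_sum, ← Finset.sum_add_distrib]
      refine Finset.sum_le_sum fun i _ => ?_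
      have e : (1 + 1 / c) * lam ^ 2 * x i ^ 2 + (1 + c) * z i ^ 2 - (lam * x i + z i) ^ 2 =
          (lam * x i - c * z i) ^ 2 / c := by
        field_simp
        ring
      have : 0 ≤ (lam * x i - c * z i) ^ 2 / c := by positivity
      linarith
    have : (1 + c) * ∑ i, z i ^ 2 ≤ (1 + c) * ((1 + c) * n) := by gcongr
    nlinarith [hcon.1]
  · rw [measurePreserving_fst.measure_preimage (MeasurableSet.nullMeasurableSet (by measurability)),
      measurePreserving_snd.measure_preimage (MeasurableSet.nullMeasurableSet (by measurability))]
    gcongr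

lemma Anm_cons {n k : ℕ} (hm : 0 < k + 1) (lam : ℝ) (x z : Fin n → ℝ) (y : Fin k → Fin n → ℝ) :
    Anm n (k + 1) hm lam (Fin.cons x y, z) =
      (∑ i, normalizedTilt n lam (Real.sqrt (∑ j, (lam * x j + z j) ^ 2)) (y i)) / k := by
  have h0 : (⟨0, hm⟩ : Fin (k + 1)) = 0 := rfl
  have hs : Real.sqrt (∑ j, (lam * x j + z j) ^ 2) ^ 2 = ∑ j, (z j + lam * x j) ^ 2 := by
    rw [Real.sq_sqrt (Finset.sum_nonneg fun _ _ => sq_nonneg _)]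
    simp only [add_comm]
  simp only [Anm, normalizedTilt, h0, Fin.cons_zero, hs]
  rw [Finset.sum_filter, Fin.sum_univ_succ]
  simp only [ne_eq, not_true_eq_false, if_false, Fin.succ_ne_zero, not_false_eq_true, if_true,
    Fin.cons_succ, zero_add]
  rw [← Finset.sum_div, div_div]
  congr 1
  push_cast
  ring

lemma measurable_Anm (n m : ℕ) (hm : 0 < m) (lam : ℝ) : Measurable (Anm n m hm lam) := by
  have h1 : ∀ i : Fin m, Measurable fun ω : (Fin m → Fin n → ℝ) × (Fin n → ℝ) =>
      firstCoord (ω.1 i) := fun i => measurable_firstCoord.comp (by fun_prop)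
  have h2 : ∀ i : Fin m, Measurable fun ω : (Fin m → Fin n → ℝ) × (Fin n → ℝ) =>
      restSq (ω.1 i) := fun i => measurable_restSq.comp (by fun_prop)
  unfold Anm
  fun_prop

lemma XZlaw_Anm_sub_one_le {n m : ℕ} (hn : 0 < n) (hm : 0 < m) (hm2 : 2 ≤ m) (lam : ℝ)
    {p c ε : ℝ} (hp : 1 ≤ p) (hp2 : p ≤ 2) (hc : 0 < c) (hε : 0 < ε) {η : ℝ}
    (hη : η = ((m - 1 : ℕ) : ℝ) ^ (1 - p) * Real.exp (lam ^ 2 / 2 *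
      (p * (p - 1) * ((1 + c) ^ 2 + c) + p ^ 2 * (lam ^ 2 / n) / 2))) :
    XZlaw n m {ω | ε < |Anm n m hm lam ω - 1|} ≤
      ENNReal.ofReal ((1 + 1 / c) / c * (lam ^ 2 / n)) +
      ENNReal.ofReal ((Real.sqrt ((n : ℝ) ^ (1 - (2 : ℝ)) *
        ∫ x, (x ^ 2) ^ (2 : ℝ) ∂(gaussianReal 0 1)) +
        2 * ((n : ℝ) ^ (1 - (2 : ℝ)) * ∫ x, (x ^ 2) ^ (2 : ℝ) ∂(gaussianReal 0 1))) / c) +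
      ENNReal.ofReal ((Real.sqrt η + 2 * η) / ε) := by
  obtain ⟨k, rfl⟩ := Nat.exists_eq_add_one.2 hm
  have hk : 0 < k := by omega
  set μ := Measure.pi fun _ : Fin n => gaussianReal 0 (n : ℝ≥0)⁻¹ with hμ
  set ν := Measure.pi fun _ : Fin n => gaussianReal 0 1 with hν
  let e := MeasurableEquiv.piFinSuccAbove (fun _ : Fin (k + 1) => Fin n → ℝ) 0
  have hmp : MeasurePreserving (Prod.map e (id : (Fin n → ℝ) → Fin n → ℝ))
      (XZlaw n (k + 1)) ((μ.prod (Measure.pi fun _ : Fin k => μ)).prod ν) :=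
    (measurePreserving_piFinSuccAbove (fun _ : Fin (k + 1) => μ) 0).prod (MeasurePreserving.id ν)
  let T : Set (((Fin n → ℝ) × (Fin k → Fin n → ℝ)) × (Fin n → ℝ)) :=
    {q | ε < |Anm n (k + 1) hm lam (e.symm q.1, q.2) - 1|}
  have hT : MeasurableSet T := by
    have h1 : Measurable fun q : ((Fin n → ℝ) × (Fin k → Fin n → ℝ)) × (Fin n → ℝ) =>
        Anm n (k + 1) hm lam (e.symm q.1, q.2) :=
      (measurable_Anm n (k + 1) hm lam).comp
        ((e.symm.measurable.comp measurable_fst).prodMk measurable_snd)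
    exact measurableSet_lt measurable_const (h1.sub_const 1).abs
  have hpre : {ω | ε < |Anm n (k + 1) hm lam ω - 1|} =
      Prod.map e (id : (Fin n → ℝ) → Fin n → ℝ) ⁻¹' T := by
    ext ω
    simp [T]
  let G : Set ((Fin n → ℝ) × (Fin n → ℝ)) :=
    {q | ∑ i, (lam * q.1 i + q.2 i) ^ 2 ≤ (1 + c) ^ 2 * n + c * n}
  have hG : MeasurableSet G := measurableSet_le (by fun_prop) measurable_const
  have hGc : Gᶜ = {q | (1 + c) ^ 2 * n + c * n < ∑ i, (lam * q.1 i + q.2 i) ^ 2} := by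
    ext q
    simp [G]
  rw [hpre, hmp.measure_preimage hT.nullMeasurableSet]
  refine (measure_prod_prod_le_of_section_le μ _ ν hT hG
    (B := ENNReal.ofReal ((Real.sqrt η + 2 * η) / ε)) ?_).trans ?_
  · rintro ⟨x, z⟩ hq
    set r := Real.sqrt (∑ j, (lam * x j + z j) ^ 2) with hr
    have hr2 : r ^ 2 ≤ (1 + ((1 + c) ^ 2 + c - 1)) * n := by
      rw [hr, Real.sq_sqrt (Finset.sum_nonneg fun _ _ => sq_nonneg _)]
      have : ∑ i, (lam * x i + z i) ^ 2 ≤ (1 + c) ^ 2 * n + c * n := hq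
      linarith
    have hsec : {b | ((x, b), z) ∈ T} =
        {b : Fin k → Fin n → ℝ | ε < |(∑ i, normalizedTilt n lam r (b i)) / k - 1|} := by
      ext b
      have : e.symm (x, b) = Fin.cons x b := by
        simp [e, MeasurableEquiv.piFinSuccAbove, Fin.consEquiv]
      simp only [T, Set.mem_ofPred, this, Anm_cons, hr]
    have hint := integrable_normalizedTilt_rpow hn lam r zero_le_one
    simp only [Real.rpow_one] at hint
    have hmom := integral_normalizedTilt_rpow_le hn lam hp hr2
    rw [add_sub_cancel] at hmom
    rw [hsec, hη]
    exact measure_average_sub_one_gt_le (measurable_normalizedTilt n lam r)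
      (normalizedTilt_nonneg n lam r) hint (integral_normalizedTilt hn lam r) hp hp2
      (integrable_normalizedTilt_rpow hn lam r (by linarith)) hk hmom hε
  · rw [hGc]
    gcongr
    exact measure_norm_sq_gt_le hn lam hc

lemma rpow_mul_exp_le {m : ℕ} (hm : 2 ≤ m) {δ l s : ℝ} (hδ : δ ∈ Set.Ioo (0 : ℝ) 1)
    (hl0 : 0 ≤ l) (hl : l ≤ (2 - δ) * Real.log m) (hs : s ≤ δ / 16 * (δ / 32)) :
    ((m - 1 : ℕ) : ℝ) ^ (1 - (1 + δ / 16)) * Real.exp (l / 2 * ((1 + δ / 16) * (1 + δ / 16 - 1) *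
      ((1 + δ / 16) ^ 2 + δ / 16) + (1 + δ / 16) ^ 2 * s / 2)) ≤
      2 * Real.exp (-(δ ^ 2 / 128) * Real.log m) := by
  obtain ⟨h0, h1⟩ := hδ
  have hm' : (2 : ℝ) ≤ m := by exact_mod_cast hm
  have hL : 0 ≤ Real.log m := Real.log_nonneg (by linarith)
  have hm1 : (m : ℝ) / 2 ≤ ((m - 1 : ℕ) : ℝ) := by
    rw [Nat.cast_sub (by omega)]
    push_cast
    linarith
  have hA : ((m - 1 : ℕ) : ℝ) ^ (1 - (1 + δ / 16)) ≤ 2 * Real.exp (-(δ / 16) * Real.log m) := by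
    calc ((m - 1 : ℕ) : ℝ) ^ (1 - (1 + δ / 16)) ≤ ((m : ℝ) / 2) ^ (1 - (1 + δ / 16)) :=
          Real.rpow_le_rpow_of_nonpos (by linarith) hm1 (by linarith)
      _ = (2 : ℝ) ^ (δ / 16) * Real.exp (-(δ / 16) * Real.log m) := by
          rw [Real.div_rpow (by linarith) (by norm_num), Real.rpow_def_of_pos (x := (m : ℝ))
            (by linarith), show 1 - (1 + δ / 16) = -(δ / 16) by ring,
            Real.rpow_neg (by norm_num), div_inv_eq_mul]
          rw [mul_comm (Real.log m), mul_comm]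
      _ ≤ 2 * Real.exp (-(δ / 16) * Real.log m) := by
          gcongr
          nth_rewrite 2 [← Real.rpow_one 2]
          exact Real.rpow_le_rpow_of_exponent_le (by norm_num) (by linarith)
  have hB : l / 2 * ((1 + δ / 16) * (1 + δ / 16 - 1) * ((1 + δ / 16) ^ 2 + δ / 16) +
      (1 + δ / 16) ^ 2 * s / 2) ≤ (δ / 16 - δ ^ 2 / 128) * Real.log m := by
    have h3 : (1 + δ / 16) * (1 + δ / 16 - 1) * ((1 + δ / 16) ^ 2 + δ / 16) ≤
        δ / 16 * (1 + 5 * (δ / 16)) := by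
      nlinarith [mul_pos h0 h0, mul_pos (mul_pos h0 h0) h0, mul_pos (mul_pos h0 h0) (sub_pos.2 h1),
        mul_pos (mul_pos (mul_pos h0 h0) h0) (sub_pos.2 h1)]
    have h4 : (1 + δ / 16) ^ 2 * s / 2 ≤ δ / 16 * (δ / 16) := by
      have : (1 + δ / 16) ^ 2 ≤ 2 ^ 2 := by
        gcongr
        linarith
      nlinarith
    have h5 : 0 ≤ δ / 16 * (1 + 5 * (δ / 16)) + δ / 16 * (δ / 16) := by positivity
    calc _ ≤ l / 2 * (δ / 16 * (1 + 5 * (δ / 16)) + δ / 16 * (δ / 16)) := by gcongr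
      _ ≤ ((2 - δ) * Real.log m) / 2 * (δ / 16 * (1 + 5 * (δ / 16)) + δ / 16 * (δ / 16)) := by
          gcongr
      _ = ((2 - δ) / 2 * (δ / 16 * (1 + 5 * (δ / 16)) + δ / 16 * (δ / 16))) * Real.log m := by
          ring
      _ ≤ _ := by
          gcongr
          nlinarith [mul_pos h0 h0, mul_pos (mul_pos h0 h0) h0]
  calc _ ≤ 2 * Real.exp (-(δ / 16) * Real.log m) *
        Real.exp ((δ / 16 - δ ^ 2 / 128) * Real.log m) := by gcongr
    _ = _ := by
        rw [mul_assoc, ← Real.exp_add]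
        ring_nf

lemma tendsto_ofReal_sqrt_add_div {u : ℕ → ℝ} (hu : Tendsto u atTop (nhds 0)) (ε : ℝ) :
    Tendsto (fun n => ENNReal.ofReal ((Real.sqrt (u n) + 2 * u n) / ε)) atTop (nhds 0) := by
  have h := ENNReal.tendsto_ofReal ((hu.sqrt.add (hu.const_mul 2)).div_const ε)
  simpa using h

/-- **Lemma 14.** If `m → ∞`, `(log m)/n → 0`, `λ_n > 0` and
`λ_n² ≤ (2−δ) log m_n` for a fixed `δ ∈ (0,1)`, then `𝒜_{n,m} → 1` in probability. -/
theorem Anm_tendsto_one_in_probability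
    (m : ℕ → ℕ) (lam : ℕ → ℝ) (δ : ℝ) (hδ : δ ∈ Set.Ioo (0 : ℝ) 1)
    (hm0 : ∀ n, 0 < m n)
    (hm : Tendsto (fun n => (m n : ℝ)) atTop atTop)
    (hlog : Tendsto (fun n => Real.log (m n) / n) atTop (nhds 0))
    (hlam : ∀ n, 0 < lam n)
    (hlam2 : ∀ n, lam n ^ 2 ≤ (2 - δ) * Real.log (m n)) :
    ∀ ε : ℝ, 0 < ε →
      Tendsto (fun n =>
          XZlaw n (m n) {ω | ε < |Anm n (m n) (hm0 n) (lam n) ω - 1|})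
        atTop (nhds (0 : ℝ≥0∞)) := by
  intro ε hε
  set c := δ / 16 with hc
  have hc0 : 0 < c := by
    have := hδ.1
    positivity
  have hc1 : c ≤ 1 := by linarith [hδ.2]
  have hL : ∀ n, 0 ≤ Real.log (m n) := fun n => Real.log_natCast_nonneg _
  have hs : Tendsto (fun n : ℕ => lam n ^ 2 / n) atTop (nhds 0) := by
    refine squeeze_zero (fun n => by positivity) (fun n => ?_)
      (by simpa using hlog.const_mul 2)
    rw [← mul_div_assoc]
    gcongr
    nlinarith [hlam2 n, hL n, hδ.1]
  set η : ℕ → ℝ := fun n => ((m n - 1 : ℕ) : ℝ) ^ (1 - (1 + c)) * Real.exp (lam n ^ 2 / 2 *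
      ((1 + c) * (1 + c - 1) * ((1 + c) ^ 2 + c) + (1 + c) ^ 2 * (lam n ^ 2 / n) / 2)) with hη
  have hm2 : ∀ᶠ n in atTop, 2 ≤ m n := by
    filter_upwards [hm.eventually_ge_atTop 2] with n hn
    exact_mod_cast hn
  have hη0 : Tendsto η atTop (nhds 0) := by
    have hexp : Tendsto (fun n => 2 * Real.exp (-(δ ^ 2 / 128) * Real.log (m n))) atTop
        (nhds 0) := by
      have h1 := (Real.tendsto_log_atTop.comp hm).const_mul_atTop_of_neg
        (show -(δ ^ 2 / 128) < 0 by
          have := hδ.1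
          have : 0 < δ ^ 2 / 128 := by positivity
          linarith)
      simpa using (Real.tendsto_exp_atBot.comp h1).const_mul 2
    have hse : ∀ᶠ n in atTop, lam n ^ 2 / n ≤ δ / 16 * (δ / 32) :=
      hs.eventually_le_const (by
        have := hδ.1
        positivity)
    refine squeeze_zero' (Eventually.of_forall fun n => by positivity) ?_ hexp
    filter_upwards [hm2, hse] with n h1 h2
    exact rpow_mul_exp_le h1 hδ (sq_nonneg _) (hlam2 n) h2
  have hn0 : Tendsto (fun n : ℕ => (n : ℝ) ^ (1 - (2 : ℝ)) *
      ∫ x, (x ^ 2) ^ (2 : ℝ) ∂(gaussianReal 0 1)) atTop (nhds 0) := by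
    have h := ((tendsto_rpow_neg_atTop one_pos).comp
      tendsto_natCast_atTop_atTop).mul_const (∫ x, (x ^ 2) ^ (2 : ℝ) ∂(gaussianReal 0 1))
    rw [zero_mul] at h
    refine h.congr fun n => ?_
    norm_num
  have hbound := ((ENNReal.tendsto_ofReal (hs.const_mul ((1 + 1 / c) / c))).add
    (tendsto_ofReal_sqrt_add_div hn0 c)).add (tendsto_ofReal_sqrt_add_div hη0 ε)
  rw [mul_zero, ENNReal.ofReal_zero, add_zero, add_zero] at hbound
  refine tendsto_of_tendsto_of_tendsto_of_le_of_le' tendsto_const_nhds hbound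
    (Eventually.of_forall fun _ => zero_le) ?_
  filter_upwards [hm2, eventually_gt_atTop 0] with n h1 h2
  exact XZlaw_Anm_sub_one_le h2 (hm0 n) h1 (lam n) (by linarith) (by linarith) hc0 hε rfl
end
end

section
/- Consider the linear regression model y = Xβ + z with σ = 1 and β ∈ ℝ^m, all of m = m_n and μ = μ_n depending on n. Let π_{±S}(μ; m) be the symmetric spike prior. Suppose n → ∞, m → ∞ and μ → 0. Then the Bayes risk satisfies B(π_{±S}(μ; m)) ≥ μ² − (μ⁴/m)·(1+o(1)); equivalently, limsup_n (μ² − B(π_{±S}(μ;m))) · m/μ⁴ ≤ 1. -/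
open MeasureTheory ProbabilityTheory Filter
open scoped NNReal ENNReal

noncomputable section

/-- Sample space for the Bayesian model with symmetric spike prior: a design matrix
`X ∈ ℝ^{n×m}`, a noise vector `z ∈ ℝ^n`, a spike location `I ∈ [m]` and a sign. -/
abbrev PMOmega (n m : ℕ) : Type :=
  ((Fin n → Fin m → ℝ) × (Fin n → ℝ)) × (Fin m × Bool)

/-- The joint law: design entries i.i.d. `N(0, 1/n)`, noise entries i.i.d. `N(0,1)`,
an independent uniform spike location in `[m]` and an independent fair sign. -/
def pmLaw (n m : ℕ) : Measure (PMOmega n m) :=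
  ((Measure.pi fun _ : Fin n => Measure.pi fun _ : Fin m => gaussianReal 0 (n : ℝ≥0)⁻¹).prod
    (Measure.pi fun _ : Fin n => gaussianReal 0 1)).prod
    ((((m : ℝ≥0∞))⁻¹ • Measure.count).prod (((2 : ℝ≥0∞))⁻¹ • Measure.count))

/-- The signal drawn from the symmetric spike prior `π_{±S}(μ; m)`: `β = ε μ e_I`. -/
def pmSignal (m : ℕ) (mu : ℝ) (Iε : Fin m × Bool) : Fin m → ℝ :=
  fun j => if j = Iε.1 then (if Iε.2 then mu else -mu) else 0

/-- The observed data `(X, y)` with `y = X β + z`. -/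
def pmData (n m : ℕ) (mu : ℝ) (ω : PMOmega n m) :
    (Fin n → Fin m → ℝ) × (Fin n → ℝ) :=
  (ω.1.1, fun i => (∑ j, ω.1.1 i j * pmSignal m mu ω.2 j) + ω.1.2 i)

/-- The Bayes risk `B(π_{±S}(μ; m)) = inf_{β̂} E_π ‖β̂(X,y) − β‖₂²`, the infimum over
all measurable estimators. -/
def pmBayesRisk (n m : ℕ) (mu : ℝ) : ℝ≥0∞ :=
  ⨅ (est : (Fin n → Fin m → ℝ) × (Fin n → ℝ) → Fin m → ℝ) (_ : Measurable est),
    ∫⁻ ω, ENNReal.ofReal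
      (∑ j, (est (pmData n m mu ω) j - pmSignal m mu ω.2 j) ^ 2) ∂ pmLaw n m

/-- The density of `N(c, I_n)` with respect to `N(0, I_n)`. -/
def gaussianShiftDensity {n : ℕ} (c y : Fin n → ℝ) : ℝ :=
  ∏ i, Real.exp (c i * y i - c i ^ 2 / 2)

lemma gaussianReal_eq_withDensity_exp (c : ℝ) :
    gaussianReal c 1 = (gaussianReal 0 1).withDensity
      (fun y => ENNReal.ofReal (Real.exp (c * y - c ^ 2 / 2))) := by
  rw [gaussianReal_of_var_ne_zero _ one_ne_zero, gaussianReal_of_var_ne_zero _ one_ne_zero,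
    ← withDensity_mul _ (by fun_prop) (by fun_prop)]
  congr 1
  ext y
  simp only [gaussianPDF, Pi.mul_apply, gaussianPDFReal]
  rw [← ENNReal.ofReal_mul (by positivity), mul_assoc (√(2 * Real.pi * _))⁻¹, ← Real.exp_add]
  congr 3
  norm_num
  ring

lemma integrable_exp_shift (c : ℝ) :
    Integrable (fun y => Real.exp (c * y - c ^ 2 / 2)) (gaussianReal 0 1) := by
  simp_rw [sub_eq_add_neg, Real.exp_add]
  exact (integrable_exp_mul_gaussianReal c).mul_const _

lemma measurable_gaussianShiftDensity {n : ℕ} :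
    Measurable fun p : (Fin n → ℝ) × (Fin n → ℝ) => gaussianShiftDensity p.1 p.2 := by
  unfold gaussianShiftDensity
  fun_prop

lemma gaussianShiftDensity_pos {n : ℕ} (c y : Fin n → ℝ) : 0 < gaussianShiftDensity c y :=
  Finset.prod_pos fun _ _ => Real.exp_pos _

lemma gaussianShiftDensity_eq_exp {n : ℕ} (c y : Fin n → ℝ) :
    gaussianShiftDensity c y = Real.exp (∑ i, c i * y i - (∑ i, c i ^ 2) / 2) := by
  rw [gaussianShiftDensity, ← Real.exp_sum, Finset.sum_sub_distrib, Finset.sum_div]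

lemma pi_gaussianReal_eq_withDensity {n : ℕ} (c : Fin n → ℝ) :
    Measure.pi (fun i => gaussianReal (c i) 1) =
      (Measure.pi fun _ : Fin n => gaussianReal 0 1).withDensity
        (fun y => ENNReal.ofReal (gaussianShiftDensity c y)) := by
  refine Measure.pi_eq fun s hs => ?_
  rw [withDensity_apply _ (MeasurableSet.univ_pi hs), Measure.restrict_pi_pi]
  have hint (i : Fin n) : Integrable (fun y => Real.exp (c i * y - c i ^ 2 / 2))
      ((gaussianReal 0 1).restrict (s i)) := (integrable_exp_shift (c i)).integrableOn
  unfold gaussianShiftDensity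
  rw [← ofReal_integral_eq_lintegral_ofReal (Integrable.fintype_prod hint)
    (ae_of_all _ fun y => Finset.prod_nonneg fun _ _ => (Real.exp_pos _).le),
    integral_fintype_prod_eq_prod (fun i y => Real.exp (c i * y - c i ^ 2 / 2)),
    ENNReal.ofReal_prod_of_nonneg
      (fun i _ => integral_nonneg fun _ => (Real.exp_pos _).le)]
  refine Finset.prod_congr rfl fun i _ => ?_
  rw [ofReal_integral_eq_lintegral_ofReal (hint i) (ae_of_all _ fun y => (Real.exp_pos _).le),
    gaussianReal_eq_withDensity_exp (c i), withDensity_apply _ (hs i)]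

lemma lintegral_gaussian_shift_s14 {n : ℕ} (c : Fin n → ℝ) {f : (Fin n → ℝ) → ℝ≥0∞}
    (hf : Measurable f) :
    ∫⁻ z, f (fun i => c i + z i) ∂(Measure.pi fun _ : Fin n => gaussianReal 0 1) =
      ∫⁻ y, ENNReal.ofReal (gaussianShiftDensity c y) * f y
        ∂(Measure.pi fun _ : Fin n => gaussianReal 0 1) := by
  have hD : Measurable fun y => ENNReal.ofReal (gaussianShiftDensity c y) := by
    unfold gaussianShiftDensity
    fun_prop
  have h := Measure.pi_map_pi (μ := fun _ : Fin n => gaussianReal 0 1)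
    (f := fun i z => c i + z) (fun i => by fun_prop)
  simp only [gaussianReal_map_const_add, zero_add] at h
  rw [pi_gaussianReal_eq_withDensity c] at h
  have h2 := lintegral_map (μ := Measure.pi fun _ : Fin n => gaussianReal 0 1) hf
    (g := fun z i => c i + z i) (by fun_prop)
  rw [← h2, h, lintegral_withDensity_eq_lintegral_mul _ hD hf]
  rfl

lemma lintegral_gaussianShiftDensity {n : ℕ} (c : Fin n → ℝ) :
    ∫⁻ y, ENNReal.ofReal (gaussianShiftDensity c y)
      ∂(Measure.pi fun _ : Fin n => gaussianReal 0 1) = 1 := by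
  simpa using (lintegral_gaussian_shift_s14 c (f := fun _ => 1) measurable_const).symm

lemma integrable_gaussianShiftDensity {n : ℕ} (c : Fin n → ℝ) :
    Integrable (gaussianShiftDensity c) (Measure.pi fun _ : Fin n => gaussianReal 0 1) :=
  Integrable.fintype_prod fun i => integrable_exp_shift (c i)

lemma integral_gaussianShiftDensity {n : ℕ} (c : Fin n → ℝ) :
    ∫ y, gaussianShiftDensity c y ∂(Measure.pi fun _ : Fin n => gaussianReal 0 1) = 1 := by
  rw [integral_eq_lintegral_of_nonneg_ae (ae_of_all _ fun y => (gaussianShiftDensity_pos c y).le)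
    (integrable_gaussianShiftDensity c).aestronglyMeasurable, lintegral_gaussianShiftDensity]
  rfl

lemma sq_gaussianShiftDensity_sub {n : ℕ} (c y : Fin n → ℝ) :
    ((gaussianShiftDensity c y - gaussianShiftDensity (-c) y) / 2) ^ 2 =
      Real.exp (∑ i, c i ^ 2) / 4 * gaussianShiftDensity ((2 : ℝ) • c) y +
      Real.exp (∑ i, c i ^ 2) / 4 * gaussianShiftDensity ((-2 : ℝ) • c) y -
      Real.exp (-∑ i, c i ^ 2) / 2 := by
  simp only [gaussianShiftDensity_eq_exp, Pi.neg_apply, Pi.smul_apply, smul_eq_mul, neg_mul,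
    mul_assoc, Finset.sum_neg_distrib, mul_pow, ← Finset.mul_sum, neg_sq]
  set t := ∑ i, c i * y i
  set a := ∑ i, c i ^ 2
  have h1 : Real.exp a * Real.exp (2 * t - 2 ^ 2 * a / 2) = Real.exp (t - a / 2) ^ 2 := by
    rw [← Real.exp_add, ← Real.exp_nat_mul]; congr 1; push_cast; ring
  have h2 : Real.exp a * Real.exp (-(2 * t) - 2 ^ 2 * a / 2) = Real.exp (-t - a / 2) ^ 2 := by
    rw [← Real.exp_add, ← Real.exp_nat_mul]; congr 1; push_cast; ring
  have h3 : Real.exp (-a) = Real.exp (t - a / 2) * Real.exp (-t - a / 2) := by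
    rw [← Real.exp_add]; congr 1; ring
  linear_combination (-1 / 4 : ℝ) * h1 - (1 / 4 : ℝ) * h2 + (1 / 2 : ℝ) * h3

lemma integrable_sq_gaussianShiftDensity_sub {n : ℕ} (c : Fin n → ℝ) :
    Integrable (fun y => ((gaussianShiftDensity c y - gaussianShiftDensity (-c) y) / 2) ^ 2)
      (Measure.pi fun _ : Fin n => gaussianReal 0 1) := by
  simp_rw [sq_gaussianShiftDensity_sub]
  exact (((integrable_gaussianShiftDensity _).const_mul _).add
    ((integrable_gaussianShiftDensity _).const_mul _)).sub (integrable_const _)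

lemma integral_sq_gaussianShiftDensity_sub {n : ℕ} (c : Fin n → ℝ) :
    ∫ y, ((gaussianShiftDensity c y - gaussianShiftDensity (-c) y) / 2) ^ 2
      ∂(Measure.pi fun _ : Fin n => gaussianReal 0 1) =
      (Real.exp (∑ i, c i ^ 2) - Real.exp (-∑ i, c i ^ 2)) / 2 := by
  simp_rw [sq_gaussianShiftDensity_sub]
  have h := ((integrable_gaussianShiftDensity ((2 : ℝ) • c)).const_mul
    (Real.exp (∑ i, c i ^ 2) / 4)).add ((integrable_gaussianShiftDensity ((-2 : ℝ) • c)).const_mul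
    (Real.exp (∑ i, c i ^ 2) / 4))
  erw [integral_sub h (integrable_const _)]
  erw [integral_add ((integrable_gaussianShiftDensity _).const_mul _)
    ((integrable_gaussianShiftDensity _).const_mul _)]
  simp only [integral_const_mul, integral_gaussianShiftDensity, integral_const, probReal_univ,
    smul_eq_mul]
  ring

lemma exp_neg_half_le_gaussianShiftDensity_add {n : ℕ} (c y : Fin n → ℝ) :
    Real.exp (-(∑ i, c i ^ 2) / 2) ≤
      (gaussianShiftDensity c y + gaussianShiftDensity (-c) y) / 2 := by
  simp only [gaussianShiftDensity_eq_exp, Pi.neg_apply, neg_mul, Finset.sum_neg_distrib, neg_sq]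
  set t := ∑ i, c i * y i
  set a := ∑ i, c i ^ 2
  have h : Real.exp (-a / 2) * Real.cosh t =
      (Real.exp (t - a / 2) + Real.exp (-t - a / 2)) / 2 := by
    rw [Real.cosh_eq, sub_eq_add_neg, sub_eq_add_neg, Real.exp_add, Real.exp_add, neg_div]
    ring
  rw [← h]
  exact le_mul_of_one_le_right (Real.exp_pos _).le (Real.one_le_cosh t)

lemma gaussianPDFReal_mul_exp_sq (s x : ℝ) {v : ℝ≥0} (hv : v ≠ 0) :
    gaussianPDFReal 0 v x * Real.exp (s * x ^ 2) =
      (√(2 * Real.pi * v))⁻¹ * Real.exp (-((1 - 2 * s * v) / (2 * v)) * x ^ 2) := by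
  have hv' : (v : ℝ) ≠ 0 := by exact_mod_cast hv
  rw [gaussianPDFReal, mul_assoc, ← Real.exp_add]
  congr 2
  field_simp
  ring

lemma integrable_exp_sq_gaussianReal {s : ℝ} {v : ℝ≥0} (hv : v ≠ 0) (h : 2 * s * v < 1) :
    Integrable (fun x => Real.exp (s * x ^ 2)) (gaussianReal 0 v) := by
  have hv' : (0 : ℝ) < v := by positivity
  rw [gaussianReal_of_var_ne_zero _ hv]
  unfold gaussianPDF
  rw [integrable_withDensity_iff_integrable_smul' (by fun_prop) (by simp)]
  simp_rw [ENNReal.toReal_ofReal (gaussianPDFReal_nonneg _ _ _), smul_eq_mul,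
    gaussianPDFReal_mul_exp_sq _ _ hv]
  exact (integrable_exp_neg_mul_sq (by apply div_pos <;> linarith)).const_mul _

lemma integral_exp_sq_gaussianReal {s : ℝ} {v : ℝ≥0} (hv : v ≠ 0) (h : 2 * s * v < 1) :
    ∫ x, Real.exp (s * x ^ 2) ∂gaussianReal 0 v = (√(1 - 2 * s * v))⁻¹ := by
  have hv' : (0 : ℝ) < v := by positivity
  have h' : 0 < 1 - 2 * s * v := by linarith
  rw [integral_gaussianReal_eq_integral_smul hv]
  simp_rw [smul_eq_mul, gaussianPDFReal_mul_exp_sq _ _ hv]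
  rw [integral_const_mul, integral_gaussian, ← Real.sqrt_inv, ← Real.sqrt_inv,
    ← Real.sqrt_mul (by positivity)]
  congr 1
  have := Real.pi_pos
  field_simp

lemma integral_exp_sum_sq_gaussianReal {n : ℕ} {s : ℝ} {v : ℝ≥0} (hv : v ≠ 0)
    (h : 2 * s * v < 1) :
    ∫ x : Fin n → ℝ, Real.exp (s * ∑ i, x i ^ 2) ∂(Measure.pi fun _ => gaussianReal 0 v) =
      ((√(1 - 2 * s * v))⁻¹) ^ n := by
  simp_rw [Finset.mul_sum, Real.exp_sum]
  rw [integral_fintype_prod_eq_pow (fun x => Real.exp (s * x ^ 2)),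
    integral_exp_sq_gaussianReal hv h, Fintype.card_fin]

lemma integrable_exp_sum_sq_gaussianReal {n : ℕ} {s : ℝ} {v : ℝ≥0} (hv : v ≠ 0)
    (h : 2 * s * v < 1) :
    Integrable (fun x : Fin n → ℝ => Real.exp (s * ∑ i, x i ^ 2))
      (Measure.pi fun _ => gaussianReal 0 v) := by
  simp_rw [Finset.mul_sum, Real.exp_sum]
  exact Integrable.fintype_prod fun i => integrable_exp_sq_gaussianReal hv h

lemma measurePreserving_column {n m : ℕ} (ν : Measure ℝ) [IsProbabilityMeasure ν] (j : Fin m) :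
    MeasurePreserving (fun (X : Fin n → Fin m → ℝ) i => X i j)
      (Measure.pi fun _ : Fin n => Measure.pi fun _ : Fin m => ν) (Measure.pi fun _ => ν) :=
  measurePreserving_pi (fun _ : Fin n => Measure.pi fun _ : Fin m => ν) (fun _ => ν)
    (f := fun _ x => x j) fun _ => measurePreserving_eval (fun _ : Fin m => ν) j

lemma inv_sqrt_pow_le {n : ℕ} (hn : 0 < n) {s : ℝ} (hs : 0 < s) (hs1 : 2 * s < 1) :
    ((√(1 - 2 * s * (n : ℝ)⁻¹))⁻¹) ^ n ≤ 1 + s / (1 - 2 * s) := by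
  have hn1 : (1 : ℝ) ≤ n := by exact_mod_cast hn
  have hn' : (n : ℝ)⁻¹ ≤ 1 := inv_le_one_of_one_le₀ hn1
  have hn0 : 0 < (n : ℝ)⁻¹ := by positivity
  have hpos : 0 < 1 - 2 * s * (n : ℝ)⁻¹ := by nlinarith
  have hr : 0 < √(1 - 2 * s * (n : ℝ)⁻¹) ^ n := by positivity
  have hsq : 1 - 2 * s ≤ (√(1 - 2 * s * (n : ℝ)⁻¹) ^ n) ^ 2 := by
    rw [← pow_mul, mul_comm n 2, pow_mul, Real.sq_sqrt hpos.le]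
    have := one_add_mul_le_pow (a := -(2 * s * (n : ℝ)⁻¹)) (by nlinarith) n
    have h2 : (n : ℝ) * -(2 * s * (n : ℝ)⁻¹) = -(2 * s) := by field_simp
    rw [h2] at this
    simpa [sub_eq_add_neg] using this
  rw [inv_pow]
  set r := √(1 - 2 * s * (n : ℝ)⁻¹) ^ n
  have hd : 0 < 1 - 2 * s := by linarith
  have hK : 0 < 1 + s / (1 - 2 * s) := by positivity
  rw [inv_le_comm₀ hr hK]
  refine le_of_sq_le_sq ?_ hr.le
  refine le_trans ?_ hsq
  have : 1 + s / (1 - 2 * s) = (1 - s) / (1 - 2 * s) := by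
    rw [eq_div_iff hd.ne', add_mul, div_mul_cancel₀ _ hd.ne']; ring
  have h1s : 0 < 1 - s := by linarith
  rw [this, inv_div, div_pow, div_le_iff₀ (by positivity)]
  nlinarith [mul_pos hd hd, sq_nonneg s]

lemma one_sub_le_inv_sqrt_pow {n : ℕ} (hn : 0 < n) {u : ℝ} (hu : 0 ≤ u) :
    1 - u ≤ ((√(1 - 2 * (-u) * (n : ℝ)⁻¹))⁻¹) ^ n := by
  have hn0 : 0 < (n : ℝ)⁻¹ := by positivity
  have hpos : 0 < 1 - 2 * (-u) * (n : ℝ)⁻¹ := by nlinarith [mul_nonneg hu hn0.le]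
  have hr : 0 < √(1 - 2 * (-u) * (n : ℝ)⁻¹) ^ n := by positivity
  have hle : √(1 - 2 * (-u) * (n : ℝ)⁻¹) ^ n ≤ Real.exp u := by
    have h1 : √(1 - 2 * (-u) * (n : ℝ)⁻¹) ≤ Real.exp (u * (n : ℝ)⁻¹) := by
      rw [Real.sqrt_le_left (Real.exp_pos _).le, ← Real.exp_nat_mul]
      have := Real.add_one_le_exp (2 * (u * (n : ℝ)⁻¹))
      push_cast
      linarith
    calc _ ≤ Real.exp (u * (n : ℝ)⁻¹) ^ n := by gcongr
      _ = Real.exp u := by rw [← Real.exp_nat_mul]; congr 1; field_simp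
  rw [inv_pow]
  calc 1 - u ≤ Real.exp (-u) := by linarith [Real.add_one_le_exp (-u)]
    _ = (Real.exp u)⁻¹ := Real.exp_neg u
    _ ≤ _ := by gcongr

lemma sum_sq_sub_pmSignal {m : ℕ} (mu : ℝ) (q : Fin m × Bool) (g : Fin m → ℝ) :
    ∑ k, (g k - pmSignal m mu q k) ^ 2 =
      ∑ k, g k ^ 2 - 2 * (if q.2 then mu else -mu) * g q.1 + mu ^ 2 := by
  have h (k : Fin m) : (g k - pmSignal m mu q k) ^ 2 = g k ^ 2 +
      if k = q.1 then (-2 * (if q.2 then mu else -mu) * g q.1 + mu ^ 2) else 0 := by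
    unfold pmSignal
    split_ifs with h1 h2 <;> first | (subst h1; ring) | ring
  simp_rw [h, Finset.sum_add_distrib, Finset.sum_ite_eq', Finset.mem_univ, if_true]
  ring

lemma sum_mul_pmSignal {m : ℕ} (mu : ℝ) (q : Fin m × Bool) (x : Fin m → ℝ) :
    ∑ j, x j * pmSignal m mu q j = (if q.2 then mu else -mu) * x q.1 := by
  simp [pmSignal, mul_comm]

lemma sq_completion_le {L W g s : ℝ} (hL : 0 < L) (hLW : 1 ≤ L * W) :
    0 ≤ L * g ^ 2 - 2 * s * g + s ^ 2 * W := by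
  have : 0 ≤ L * (L * g ^ 2 - 2 * s * g + s ^ 2 * W) := by
    nlinarith [sq_nonneg (L * g - s), mul_nonneg (sub_nonneg.2 hLW) (sq_nonneg s)]
  exact nonneg_of_mul_nonneg_right this hL

/-- Completing the square in the weighted quadratic loss of an arbitrary estimate `g` when the
spike `± mu e_j` has weight proportional to `p j`, respectively `q j`. -/
lemma weighted_spike_loss_lower {m : ℕ} (hm : 0 < m) (mu : ℝ) {p q : Fin m → ℝ} {W : ℝ}
    (g : Fin m → ℝ) (hL : 0 < ∑ j, (p j + q j)) (hLW : 1 ≤ (∑ j, (p j + q j)) / (2 * m) * W) :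
    (∑ j, (p j * mu ^ 2 + q j * mu ^ 2)) / (2 * m) ≤
      (∑ j, (p j * (∑ k, g k ^ 2 - 2 * mu * g j + mu ^ 2) +
        q j * (∑ k, g k ^ 2 - 2 * (-mu) * g j + mu ^ 2))) / (2 * m) +
      (mu / m) ^ 2 * W * ∑ j, ((p j - q j) / 2) ^ 2 := by
  have hm' : (0 : ℝ) < m := by exact_mod_cast hm
  have key : 0 ≤ ∑ j, ((∑ j, (p j + q j)) / (2 * m) * g j ^ 2
      - 2 * (mu / m * ((p j - q j) / 2)) * g j + (mu / m * ((p j - q j) / 2)) ^ 2 * W) :=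
    Finset.sum_nonneg fun j _ => sq_completion_le (by positivity) hLW
  have e1 : ∑ j, ((∑ j, (p j + q j)) / (2 * m) * g j ^ 2
      - 2 * (mu / m * ((p j - q j) / 2)) * g j + (mu / m * ((p j - q j) / 2)) ^ 2 * W) =
      (∑ j, (p j + q j)) / (2 * m) * ∑ j, g j ^ 2 - (mu / m) * ∑ j, (p j - q j) * g j
      + (mu / m) ^ 2 * W * ∑ j, ((p j - q j) / 2) ^ 2 := by
    rw [Finset.mul_sum, Finset.mul_sum, Finset.mul_sum, ← Finset.sum_sub_distrib,
      ← Finset.sum_add_distrib]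
    exact Finset.sum_congr rfl fun j _ => by ring
  have e2 : ∑ j, (p j * (∑ k, g k ^ 2 - 2 * mu * g j + mu ^ 2) +
        q j * (∑ k, g k ^ 2 - 2 * (-mu) * g j + mu ^ 2)) =
      (∑ j, (p j + q j)) * ∑ j, g j ^ 2 - 2 * mu * ∑ j, (p j - q j) * g j
      + ∑ j, (p j * mu ^ 2 + q j * mu ^ 2) := by
    generalize ∑ k, g k ^ 2 = G
    rw [Finset.mul_sum, Finset.sum_mul, ← Finset.sum_sub_distrib, ← Finset.sum_add_distrib]
    exact Finset.sum_congr rfl fun j _ => by ring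
  rw [e1] at key
  rw [e2, add_div, sub_div]
  have e3 : 2 * mu * (∑ j, (p j - q j) * g j) / (2 * m) =
      (mu / m) * ∑ j, (p j - q j) * g j := by field_simp
  have e4 : (∑ j, (p j + q j)) * (∑ j, g j ^ 2) / (2 * m) =
      (∑ j, (p j + q j)) / (2 * m) * ∑ j, g j ^ 2 := by ring
  rw [e3, e4]
  linarith

/-- Jensen: the mean likelihood times the mean of `exp (a j / 2)` is at least one. -/
lemma one_le_mean_mul_mean_exp {m : ℕ} (hm : 0 < m) {r a : Fin m → ℝ}
    (h : ∀ j, Real.exp (-a j / 2) ≤ r j / 2) :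
    1 ≤ (∑ j, r j) / (2 * m) * ((∑ j, Real.exp (a j / 2)) / m) := by
  have hm' : (0 : ℝ) < m := by exact_mod_cast hm
  have hc := Finset.sum_sq_le_sum_mul_sum_of_sq_le_mul Finset.univ
    (r := fun _ : Fin m => (1 : ℝ)) (f := fun j => Real.exp (-a j / 2))
    (g := fun j => Real.exp (a j / 2)) (fun j _ => (Real.exp_pos _).le)
    (fun j _ => (Real.exp_pos _).le)
    (fun j _ => by rw [← Real.exp_add, neg_div, neg_add_cancel, Real.exp_zero, one_pow])
  have h1 : ∑ j, Real.exp (-a j / 2) ≤ (∑ j, r j) / 2 := by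
    rw [Finset.sum_div]; exact Finset.sum_le_sum fun j _ => h j
  have h2 : 0 ≤ ∑ j, Real.exp (a j / 2) := Finset.sum_nonneg fun j _ => (Real.exp_pos _).le
  simp only [Finset.sum_const, Finset.card_univ, Fintype.card_fin, nsmul_eq_mul, mul_one] at hc
  have h3 : (∑ j, r j) / (2 * m) * ((∑ j, Real.exp (a j / 2)) / m) =
    ((∑ j, r j) / 2 * ∑ j, Real.exp (a j / 2)) / m ^ 2 := by field_simp
  rw [h3, one_le_div (by positivity)]
  exact hc.trans (mul_le_mul_of_nonneg_right h1 h2)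

lemma sum_exp_half_mul_sum_sinh_le {m : ℕ} (hm : 0 < m) (a : Fin m → ℝ) :
    (∑ j, Real.exp (a j / 2)) / m * ∑ j, (Real.exp (a j) - Real.exp (-a j)) / 2 ≤
      ∑ j, (Real.exp (3 / 2 * a j) - Real.exp (-(1 / 2) * a j)) / 2 := by
  have hm' : (0 : ℝ) < m := by exact_mod_cast hm
  have hmono : Monovary (fun j => Real.exp (a j / 2))
      (fun j => (Real.exp (a j) - Real.exp (-a j)) / 2) := by
    intro i j hij
    by_contra! hlt
    have hle : a j ≤ a i := by have := Real.exp_lt_exp.1 hlt; linarith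
    have h1 := Real.exp_le_exp.2 hle
    have h2 := Real.exp_le_exp.2 (neg_le_neg hle)
    linarith
  have hc := hmono.sum_mul_sum_le_card_mul_sum
  rw [div_mul_eq_mul_div, div_le_iff₀ hm']
  refine hc.trans (le_of_eq ?_)
  rw [Fintype.card_fin, mul_comm]
  congr 1
  refine Finset.sum_congr rfl fun j _ => ?_
  rw [mul_div_assoc', mul_sub, ← Real.exp_add, ← Real.exp_add]
  ring_nf

lemma measurable_pmData (n m : ℕ) (mu : ℝ) : Measurable (pmData n m mu) := by
  have h (j : Fin m) : Measurable fun ω : PMOmega n m => pmSignal m mu ω.2 j :=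
    (measurable_of_countable fun q : Fin m × Bool => pmSignal m mu q j).comp measurable_snd
  unfold pmData
  fun_prop

/-- The mean vector `Xβ` of the observation when the spike is `q`. -/
def spikeMean {n m : ℕ} (mu : ℝ) (X : Fin n → Fin m → ℝ) (q : Fin m × Bool) : Fin n → ℝ :=
  fun i => (if q.2 then mu else -mu) * X i q.1

lemma measurable_spikeMean (n m : ℕ) (mu : ℝ) :
    Measurable fun ω : PMOmega n m => spikeMean mu ω.1.1 ω.2 := by
  refine measurable_from_prod_countable_left fun q => ?_
  have h (i : Fin n) : Measurable fun p : (Fin n → Fin m → ℝ) × (Fin n → ℝ) =>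
      (if q.2 then mu else -mu) * p.1 i q.1 := by fun_prop
  exact measurable_pi_lambda _ h

lemma measurable_density_spikeMean (n m : ℕ) (mu : ℝ) :
    Measurable fun ω : PMOmega n m => gaussianShiftDensity (spikeMean mu ω.1.1 ω.2) ω.1.2 :=
  measurable_gaussianShiftDensity.comp
    ((measurable_spikeMean n m mu).prodMk (measurable_snd.comp measurable_fst))

lemma lintegral_spikeMean_add (n m : ℕ) (mu : ℝ) (q : Fin m × Bool)
    (ν : Measure (Fin n → Fin m → ℝ)) [SFinite ν]
    {F : (Fin n → Fin m → ℝ) × (Fin n → ℝ) → ℝ≥0∞} (hF : Measurable F) :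
    ∫⁻ p, F (p.1, fun i => spikeMean mu p.1 q i + p.2 i)
        ∂ν.prod (Measure.pi fun _ : Fin n => gaussianReal 0 1) =
      ∫⁻ p, ENNReal.ofReal (gaussianShiftDensity (spikeMean mu p.1 q) p.2) * F p
        ∂ν.prod (Measure.pi fun _ : Fin n => gaussianReal 0 1) := by
  have hq : Measurable fun X : Fin n → Fin m → ℝ => spikeMean mu X q := by
    unfold spikeMean
    fun_prop
  have h1 : Measurable fun p : (Fin n → Fin m → ℝ) × (Fin n → ℝ) =>
      F (p.1, fun i => spikeMean mu p.1 q i + p.2 i) := by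
    have (i : Fin n) : Measurable fun X : Fin n → Fin m → ℝ => spikeMean mu X q i :=
      (measurable_pi_apply i).comp hq
    fun_prop
  have h2 : Measurable fun p : (Fin n → Fin m → ℝ) × (Fin n → ℝ) =>
      ENNReal.ofReal (gaussianShiftDensity (spikeMean mu p.1 q) p.2) * F p :=
    (measurable_gaussianShiftDensity.comp
      ((hq.comp measurable_fst).prodMk measurable_snd)).ennreal_ofReal.mul hF
  rw [lintegral_prod _ h1.aemeasurable, lintegral_prod _ h2.aemeasurable]
  exact lintegral_congr fun X => lintegral_gaussian_shift_s14 (spikeMean mu X q)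
    (hF.comp measurable_prodMk_left)

/-- Change of measure: the noise is turned into the observation at the cost of a density. -/
lemma lintegral_pmData (n m : ℕ) (mu : ℝ) {H : PMOmega n m → ℝ≥0∞} (hH : Measurable H) :
    ∫⁻ ω, H (pmData n m mu ω, ω.2) ∂pmLaw n m =
      ∫⁻ ω, ENNReal.ofReal (gaussianShiftDensity (spikeMean mu ω.1.1 ω.2) ω.1.2) * H ω
        ∂pmLaw n m := by
  have hD : Measurable fun ω : PMOmega n m =>
      ENNReal.ofReal (gaussianShiftDensity (spikeMean mu ω.1.1 ω.2) ω.1.2) * H ω :=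
    (measurable_density_spikeMean n m mu).ennreal_ofReal.mul hH
  have hL : Measurable fun ω : PMOmega n m => H (pmData n m mu ω, ω.2) :=
    hH.comp ((measurable_pmData n m mu).prodMk measurable_snd)
  have e (p : (Fin n → Fin m → ℝ) × (Fin n → ℝ)) (q : Fin m × Bool) :
      pmData n m mu (p, q) = (p.1, fun i => spikeMean mu p.1 q i + p.2 i) := by
    simp only [pmData, sum_mul_pmSignal, spikeMean]
  unfold pmLaw
  rw [lintegral_prod_symm' _ hL, lintegral_prod_symm' _ hD]
  refine lintegral_congr fun q => ?_
  simp only [e]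
  exact lintegral_spikeMean_add n m mu q _ (F := fun p => H (p, q))
    (hH.comp measurable_prodMk_right)

lemma lintegral_uniform_spike {m : ℕ} (hm : 0 < m) {h : Fin m × Bool → ℝ} (hh : ∀ q, 0 ≤ h q) :
    ∫⁻ q, ENNReal.ofReal (h q) ∂((((m : ℝ≥0∞))⁻¹ • Measure.count).prod
      (((2 : ℝ≥0∞))⁻¹ • Measure.count)) =
      ENNReal.ofReal ((∑ j, (h (j, true) + h (j, false))) / (2 * m)) := by
  have hm' : (0 : ℝ) < m := by exact_mod_cast hm
  rw [lintegral_prod _ (measurable_of_countable _).aemeasurable]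
  simp only [lintegral_smul_measure, lintegral_count, tsum_fintype, Fintype.sum_bool, smul_eq_mul]
  have e (j : Fin m) :
      (2 : ℝ≥0∞)⁻¹ * (ENNReal.ofReal (h (j, true)) + ENNReal.ofReal (h (j, false))) =
      ENNReal.ofReal ((h (j, true) + h (j, false)) / 2) := by
    rw [← ENNReal.ofReal_add (hh _) (hh _), ENNReal.ofReal_div_of_pos two_pos,
      ENNReal.ofReal_ofNat, ENNReal.div_eq_inv_mul]
  simp_rw [e]
  rw [← ENNReal.ofReal_sum_of_nonneg fun j _ => div_nonneg (add_nonneg (hh _) (hh _)) two_pos.le,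
    ← ENNReal.ofReal_natCast m, ← ENNReal.ofReal_inv_of_pos hm',
    ← ENNReal.ofReal_mul (by positivity)]
  congr 1
  rw [← Finset.sum_div]
  field_simp

lemma isProbabilityMeasure_pmLaw (n : ℕ) {m : ℕ} (hm : 0 < m) :
    IsProbabilityMeasure (pmLaw n m) := by
  have h := lintegral_uniform_spike hm (h := fun _ => 1) fun _ => zero_le_one
  have hm' : (m : ℝ) ≠ 0 := by exact_mod_cast hm.ne'
  have e : (∑ _j : Fin m, ((1 : ℝ) + 1)) / (2 * m) = 1 := by
    rw [Finset.sum_const, Finset.card_univ, Fintype.card_fin, nsmul_eq_mul]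
    field_simp
    norm_num
  rw [e, ENNReal.ofReal_one, lintegral_one] at h
  have : IsProbabilityMeasure ((((m : ℝ≥0∞))⁻¹ • (Measure.count : Measure (Fin m))).prod
      (((2 : ℝ≥0∞))⁻¹ • (Measure.count : Measure Bool))) := ⟨h⟩
  unfold pmLaw
  infer_instance

lemma pmBayesRisk_le_sq (n : ℕ) {m : ℕ} (hm : 0 < m) (mu : ℝ) :
    pmBayesRisk n m mu ≤ ENNReal.ofReal (mu ^ 2) := by
  have := isProbabilityMeasure_pmLaw n hm
  refine (iInf₂_le (fun _ _ => 0) measurable_const).trans (le_of_eq ?_)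
  have e (ω : PMOmega n m) : ∑ j, ((0 : ℝ) - pmSignal m mu ω.2 j) ^ 2 = mu ^ 2 := by
    rw [sum_sq_sub_pmSignal mu ω.2 (fun _ => 0)]
    simp
  simp_rw [e]
  rw [lintegral_const, measure_univ, mul_one]

/-- The pointwise upper bound on the weighted squared norm of the posterior mean. -/
def posteriorBound {n m : ℕ} (mu : ℝ) (X : Fin n → Fin m → ℝ) (y : Fin n → ℝ) : ℝ :=
  (mu / m) ^ 2 * ((∑ j, Real.exp ((∑ i, (mu * X i j) ^ 2) / 2)) / m) *
    ∑ j, ((gaussianShiftDensity (fun i => mu * X i j) y -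
      gaussianShiftDensity (-fun i => mu * X i j) y) / 2) ^ 2

lemma posteriorBound_nonneg {n m : ℕ} (mu : ℝ) (X : Fin n → Fin m → ℝ) (y : Fin n → ℝ) :
    0 ≤ posteriorBound mu X y := by
  unfold posteriorBound
  positivity

lemma measurable_posteriorBound (n m : ℕ) (mu : ℝ) :
    Measurable fun p : (Fin n → Fin m → ℝ) × (Fin n → ℝ) => posteriorBound mu p.1 p.2 := by
  unfold posteriorBound gaussianShiftDensity
  fun_prop

lemma spike_loss_add_posteriorBound {n m : ℕ} (hm : 0 < m) (mu : ℝ) (X : Fin n → Fin m → ℝ)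
    (y : Fin n → ℝ) (g : Fin m → ℝ) :
    ∫⁻ q, ENNReal.ofReal (gaussianShiftDensity (spikeMean mu X q) y) * ENNReal.ofReal (mu ^ 2)
        ∂((((m : ℝ≥0∞))⁻¹ • Measure.count).prod (((2 : ℝ≥0∞))⁻¹ • Measure.count)) ≤
      ∫⁻ q, ENNReal.ofReal (gaussianShiftDensity (spikeMean mu X q) y) *
          ENNReal.ofReal (∑ k, (g k - pmSignal m mu q k) ^ 2)
        ∂((((m : ℝ≥0∞))⁻¹ • Measure.count).prod (((2 : ℝ≥0∞))⁻¹ • Measure.count)) +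
      ENNReal.ofReal (posteriorBound mu X y) := by
  have : Nonempty (Fin m) := ⟨⟨0, hm⟩⟩
  have hpos (q : Fin m × Bool) := (gaussianShiftDensity_pos (spikeMean mu X q) y).le
  have hsum (q : Fin m × Bool) : 0 ≤ ∑ k, (g k - pmSignal m mu q k) ^ 2 := by positivity
  have e1 (j : Fin m) : spikeMean mu X (j, true) = fun i => mu * X i j := by
    ext i; simp [spikeMean]
  have e2 (j : Fin m) : spikeMean mu X (j, false) = -fun i => mu * X i j := by
    ext i; simp [spikeMean]
  simp_rw [← ENNReal.ofReal_mul (hpos _)]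
  rw [lintegral_uniform_spike hm fun q => mul_nonneg (hpos q) (sq_nonneg mu),
    lintegral_uniform_spike hm fun q => mul_nonneg (hpos q) (hsum q),
    ← ENNReal.ofReal_add _ (posteriorBound_nonneg mu X y)]
  · refine ENNReal.ofReal_le_ofReal ?_
    simp only [sum_sq_sub_pmSignal, e1, e2, if_true, Bool.false_eq_true, if_false]
    refine weighted_spike_loss_lower hm mu g
      (Finset.sum_pos (fun j _ => add_pos (gaussianShiftDensity_pos _ _)
        (gaussianShiftDensity_pos _ _)) Finset.univ_nonempty) ?_
    exact one_le_mean_mul_mean_exp hm fun j => exp_neg_half_le_gaussianShiftDensity_add _ y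
  · exact div_nonneg (Finset.sum_nonneg fun j _ => add_nonneg
      (mul_nonneg (hpos _) (hsum _)) (mul_nonneg (hpos _) (hsum _))) (by positivity)

lemma sq_le_pmRisk_add (n : ℕ) {m : ℕ} (hm : 0 < m) (mu : ℝ)
    {est : (Fin n → Fin m → ℝ) × (Fin n → ℝ) → Fin m → ℝ} (hest : Measurable est) :
    ENNReal.ofReal (mu ^ 2) ≤
      ∫⁻ ω, ENNReal.ofReal (∑ j, (est (pmData n m mu ω) j - pmSignal m mu ω.2 j) ^ 2) ∂pmLaw n m +
      ∫⁻ X, ∫⁻ y, ENNReal.ofReal (posteriorBound mu X y)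
        ∂(Measure.pi fun _ : Fin n => gaussianReal 0 1)
        ∂(Measure.pi fun _ : Fin n => Measure.pi fun _ : Fin m => gaussianReal 0 (n : ℝ≥0)⁻¹) := by
  have := isProbabilityMeasure_pmLaw n hm
  have hsig (j : Fin m) : Measurable fun ω : PMOmega n m => pmSignal m mu ω.2 j :=
    (measurable_of_countable fun q : Fin m × Bool => pmSignal m mu q j).comp measurable_snd
  have hH : Measurable fun ω : PMOmega n m =>
      ENNReal.ofReal (∑ j, (est ω.1 j - pmSignal m mu ω.2 j) ^ 2) := by
    fun_prop
  have hD := (measurable_density_spikeMean n m mu).ennreal_ofReal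
  have hDH : Measurable fun ω : PMOmega n m =>
      ENNReal.ofReal (gaussianShiftDensity (spikeMean mu ω.1.1 ω.2) ω.1.2) *
        ENNReal.ofReal (∑ j, (est ω.1 j - pmSignal m mu ω.2 j) ^ 2) := hD.mul hH
  have h0 := lintegral_pmData n m mu (H := fun _ => ENNReal.ofReal (mu ^ 2)) measurable_const
  rw [lintegral_const, measure_univ, mul_one] at h0
  have h1 := lintegral_pmData n m mu hH
  have hB := (measurable_posteriorBound n m mu).ennreal_ofReal
  rw [h0, h1, ← lintegral_prod _ hB.aemeasurable]
  unfold pmLaw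
  rw [lintegral_prod _ (hD.mul_const _).aemeasurable, lintegral_prod _ hDH.aemeasurable,
    ← lintegral_add_right _ hB]
  exact lintegral_mono fun p => spike_loss_add_posteriorBound hm mu p.1 p.2 (est p)

lemma lintegral_posteriorBound_le {n m : ℕ} (hm : 0 < m) (mu : ℝ) (X : Fin n → Fin m → ℝ) :
    ∫⁻ y, ENNReal.ofReal (posteriorBound mu X y)
        ∂(Measure.pi fun _ : Fin n => gaussianReal 0 1) ≤
      ENNReal.ofReal ((mu / m) ^ 2 * ∑ j, (Real.exp (3 / 2 * mu ^ 2 * ∑ i, X i j ^ 2) -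
        Real.exp (-(1 / 2 * mu ^ 2) * ∑ i, X i j ^ 2)) / 2) := by
  have hint := integrable_finsetSum Finset.univ fun (j : Fin m) _ =>
    integrable_sq_gaussianShiftDensity_sub fun i => mu * X i j
  unfold posteriorBound
  rw [← ofReal_integral_eq_lintegral_ofReal (hint.const_mul _)
    (ae_of_all _ fun y => posteriorBound_nonneg mu X y), integral_const_mul,
    integral_finsetSum _ fun j _ => integrable_sq_gaussianShiftDensity_sub _]
  simp_rw [integral_sq_gaussianShiftDensity_sub]
  refine ENNReal.ofReal_le_ofReal ?_
  rw [mul_assoc]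
  refine mul_le_mul_of_nonneg_left ((sum_exp_half_mul_sum_sinh_le hm _).trans (le_of_eq ?_))
    (sq_nonneg _)
  simp_rw [mul_pow, ← Finset.mul_sum]
  refine Finset.sum_congr rfl fun j _ => ?_
  congr 3 <;> ring

lemma lintegral_design_posteriorBound_le {n m : ℕ} (hn : 0 < n) (hm : 0 < m) {mu : ℝ}
    (hmu0 : 0 < mu) (hmu : 3 * mu ^ 2 < 1) :
    ∫⁻ X, ∫⁻ y, ENNReal.ofReal (posteriorBound mu X y)
        ∂(Measure.pi fun _ : Fin n => gaussianReal 0 1)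
        ∂(Measure.pi fun _ : Fin n => Measure.pi fun _ : Fin m => gaussianReal 0 (n : ℝ≥0)⁻¹) ≤
      ENNReal.ofReal (mu ^ 4 / m * (3 / (4 * (1 - 3 * mu ^ 2)) + 1 / 4)) := by
  have hm' : (0 : ℝ) < m := by exact_mod_cast hm
  have hn1 : (1 : ℝ) ≤ n := by exact_mod_cast hn
  have hn' : (n : ℝ)⁻¹ ≤ 1 := inv_le_one_of_one_le₀ hn1
  have hn0 : 0 < (n : ℝ)⁻¹ := by positivity
  have hv : (n : ℝ≥0)⁻¹ ≠ 0 := by positivity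
  have hs1 : 2 * (3 / 2 * mu ^ 2) * ((n : ℝ≥0)⁻¹ : ℝ≥0) < 1 := by
    push_cast
    nlinarith [sq_nonneg mu]
  have hs2 : 2 * (-(1 / 2 * mu ^ 2)) * ((n : ℝ≥0)⁻¹ : ℝ≥0) < 1 := by
    push_cast
    nlinarith [mul_nonneg (sq_nonneg mu) hn0.le]
  have hcol (j : Fin m) {s : ℝ} (hs : 2 * s * ((n : ℝ≥0)⁻¹ : ℝ≥0) < 1) :
      Integrable (fun X : Fin n → Fin m → ℝ => Real.exp (s * ∑ i, X i j ^ 2))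
        (Measure.pi fun _ : Fin n => Measure.pi fun _ : Fin m => gaussianReal 0 (n : ℝ≥0)⁻¹) :=
    (measurePreserving_column _ j).integrable_comp_of_integrable
      (integrable_exp_sum_sq_gaussianReal hv hs)
  have hval (j : Fin m) {s : ℝ} (hs : 2 * s * ((n : ℝ≥0)⁻¹ : ℝ≥0) < 1) :
      ∫ X : Fin n → Fin m → ℝ, Real.exp (s * ∑ i, X i j ^ 2)
        ∂(Measure.pi fun _ : Fin n => Measure.pi fun _ : Fin m => gaussianReal 0 (n : ℝ≥0)⁻¹) =
        ((√(1 - 2 * s * (n : ℝ)⁻¹))⁻¹) ^ n := by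
    have hp := measurePreserving_column (n := n) (gaussianReal 0 (n : ℝ≥0)⁻¹) j
    have h := integral_exp_sum_sq_gaussianReal (n := n) hv hs
    rw [← hp.map_eq, integral_map hp.measurable.aemeasurable
      (by fun_prop : Measurable _).aestronglyMeasurable] at h
    simpa using h
  have hint (j : Fin m) : Integrable (fun X : Fin n → Fin m → ℝ =>
      (Real.exp (3 / 2 * mu ^ 2 * ∑ i, X i j ^ 2) -
        Real.exp (-(1 / 2 * mu ^ 2) * ∑ i, X i j ^ 2)) / 2)
      (Measure.pi fun _ : Fin n => Measure.pi fun _ : Fin m => gaussianReal 0 (n : ℝ≥0)⁻¹) :=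
    ((hcol j hs1).sub (hcol j hs2)).div_const 2
  have hsum := (integrable_finsetSum Finset.univ fun (j : Fin m) _ => hint j).const_mul
    ((mu / m) ^ 2)
  refine (lintegral_mono fun X => lintegral_posteriorBound_le hm mu X).trans ?_
  have hnn (X : Fin n → Fin m → ℝ) (j : Fin m) :
      0 ≤ (Real.exp (3 / 2 * mu ^ 2 * ∑ i, X i j ^ 2) -
        Real.exp (-(1 / 2 * mu ^ 2) * ∑ i, X i j ^ 2)) / 2 := by
    have : 0 ≤ mu ^ 2 * ∑ i, X i j ^ 2 := by positivity
    refine div_nonneg (sub_nonneg.2 (Real.exp_le_exp.2 ?_)) two_pos.le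
    linarith
  rw [← ofReal_integral_eq_lintegral_ofReal hsum
    (ae_of_all _ fun X => mul_nonneg (sq_nonneg _) (Finset.sum_nonneg fun j _ => hnn X j))]
  refine ENNReal.ofReal_le_ofReal ?_
  rw [integral_const_mul]
  have hI : ∫ X : Fin n → Fin m → ℝ, (∑ j, (Real.exp (3 / 2 * mu ^ 2 * ∑ i, X i j ^ 2) -
        Real.exp (-(1 / 2 * mu ^ 2) * ∑ i, X i j ^ 2)) / 2)
        ∂(Measure.pi fun _ : Fin n => Measure.pi fun _ : Fin m => gaussianReal 0 (n : ℝ≥0)⁻¹) =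
      m * ((((√(1 - 2 * (3 / 2 * mu ^ 2) * (n : ℝ)⁻¹))⁻¹) ^ n -
        ((√(1 - 2 * (-(1 / 2 * mu ^ 2)) * (n : ℝ)⁻¹))⁻¹) ^ n) / 2) := by
    rw [integral_finsetSum _ fun j _ => hint j]
    simp_rw [integral_div]
    rw [Finset.sum_congr rfl fun j _ => by
      rw [integral_sub (hcol j hs1) (hcol j hs2), hval j hs1, hval j hs2]]
    simp
  rw [hI]
  have hu := inv_sqrt_pow_le hn (s := 3 / 2 * mu ^ 2) (by positivity) (by linarith)
  have hl := one_sub_le_inv_sqrt_pow hn (u := 1 / 2 * mu ^ 2) (by positivity)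
  have hd : 0 < 1 - 3 * mu ^ 2 := by linarith
  have e : 3 / 2 * mu ^ 2 / (1 - 2 * (3 / 2 * mu ^ 2)) =
      mu ^ 2 * 2 * (3 / (4 * (1 - 3 * mu ^ 2))) := by
    rw [show 1 - 2 * (3 / 2 * mu ^ 2) = 1 - 3 * mu ^ 2 by ring]
    field_simp
    norm_num
  rw [e] at hu
  calc _ = mu ^ 2 / m * ((((√(1 - 2 * (3 / 2 * mu ^ 2) * (n : ℝ)⁻¹))⁻¹) ^ n -
        ((√(1 - 2 * (-(1 / 2 * mu ^ 2)) * (n : ℝ)⁻¹))⁻¹) ^ n) / 2) := by field_simp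
    _ ≤ mu ^ 2 / m * (mu ^ 2 * (3 / (4 * (1 - 3 * mu ^ 2)) + 1 / 4)) := by
        gcongr
        linarith
    _ = _ := by ring

/-- Non-asymptotic lower bound on the Bayes risk of the symmetric spike prior. -/
theorem sq_sub_le_pmBayesRisk {n m : ℕ} (hn : 0 < n) (hm : 0 < m) {mu : ℝ}
    (hmu0 : 0 < mu) (hmu : 3 * mu ^ 2 < 1) :
    mu ^ 2 - mu ^ 4 / m * (3 / (4 * (1 - 3 * mu ^ 2)) + 1 / 4) ≤ (pmBayesRisk n m mu).toReal := by
  have hd : 0 < 1 - 3 * mu ^ 2 := by linarith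
  have htop : pmBayesRisk n m mu ≠ ∞ :=
    ((pmBayesRisk_le_sq n hm mu).trans_lt ENNReal.ofReal_lt_top).ne
  rw [← ENNReal.ofReal_le_iff_le_toReal htop, ENNReal.ofReal_sub _ (by positivity)]
  refine le_iInf₂ fun est hest => tsub_le_iff_right.2 ?_
  exact (sq_le_pmRisk_add n hm mu hest).trans
    (add_le_add le_rfl (lintegral_design_posteriorBound_le hn hm hmu0 hmu))

/-- **Lemma 8.** For the symmetric spike prior with `m → ∞` and `μ → 0`, the Bayes risk
satisfies `B(π_{±S}(μ; m)) ≥ μ² − (μ⁴/m)(1 + o(1))`, i.e.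
`limsup (μ² − B) · m/μ⁴ ≤ 1`. -/
theorem pm_spike_bayes_risk_lower_lowSNR
    (m : ℕ → ℕ) (mu : ℕ → ℝ)
    (hm0 : ∀ n, 0 < m n) (hmu0 : ∀ n, 0 < mu n)
    (hm : Tendsto (fun n => (m n : ℝ)) atTop atTop)
    (hmu : Tendsto (fun n => mu n) atTop (nhds 0)) :
    Filter.limsup (fun n =>
        (mu n ^ 2 - (pmBayesRisk n (m n) (mu n)).toReal) * m n / mu n ^ 4) atTop
      ≤ 1 := by
  have hlim : Tendsto (fun n => 3 / (4 * (1 - 3 * mu n ^ 2)) + 1 / 4) atTop (nhds (1 : ℝ)) := by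
    have h1 : Tendsto (fun n => 4 * (1 - 3 * mu n ^ 2)) atTop (nhds (4 * (1 - 3 * 0 ^ 2))) :=
      ((hmu.pow 2).const_mul 3 |>.const_sub 1).const_mul 4
    have h2 := ((tendsto_const_nhds (x := (3 : ℝ))).div h1 (by norm_num)).add_const (1 / 4)
    norm_num at h2
    simpa using h2
  have hsmall : ∀ᶠ n in atTop, 3 * mu n ^ 2 < 1 := by
    have h := (hmu.pow 2).const_mul 3
    exact h.eventually_lt_const (by norm_num)
  have hbound : (fun n => (mu n ^ 2 - (pmBayesRisk n (m n) (mu n)).toReal) * m n / mu n ^ 4)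
      ≤ᶠ[atTop] fun n => 3 / (4 * (1 - 3 * mu n ^ 2)) + 1 / 4 := by
    filter_upwards [hsmall, eventually_gt_atTop 0] with n hn hn0
    have h := sq_sub_le_pmBayesRisk hn0 (hm0 n) (hmu0 n) hn
    have hm' : (0 : ℝ) < m n := by exact_mod_cast hm0 n
    have hmu' := hmu0 n
    rw [div_le_iff₀ (by positivity), ← le_div_iff₀ hm']
    calc _ ≤ mu n ^ 4 / m n * (3 / (4 * (1 - 3 * mu n ^ 2)) + 1 / 4) := by linarith
      _ = _ := by ring
  have hnonneg (n : ℕ) :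
      0 ≤ (mu n ^ 2 - (pmBayesRisk n (m n) (mu n)).toReal) * m n / mu n ^ 4 := by
    have h := ENNReal.toReal_le_of_le_ofReal (sq_nonneg _) (pmBayesRisk_le_sq n (hm0 n) (mu n))
    have := sub_nonneg.2 h
    positivity
  rw [← hlim.limsup_eq]
  exact limsup_le_limsup hbound
    (IsBoundedUnder.isCoboundedUnder_le (isBoundedUnder_of ⟨0, hnonneg⟩)) hlim.isBoundedUnder_le
end
end
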